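/- arXiv:1504.04847 — 4 statements merged into one kernel-verified Lean document; each statement's English description precedes it below -/
import Mathlib

section
/- Let N ≥ 2, let t be a real number with 0 ≤ t < N, and let 0 < α < α_{N,t} := (N-t)·ω_{N-1}^{1/(N-1)}. Then there exists a positive constant C = C(N,t,α) such that for every function u ∈ L^N(ℝ^N;|x|^{-t}dx) ∩ Ẇ^{1,N}(ℝ^N) with ∫_{ℝ^N}|∇u|^N dx ≤ 1, one has ∫_{ℝ^N} e^{α|u(x)|^{N/(N-1)}} |u(x)|^N |x|^{-t} dx ≤ C ∫_{ℝ^N} |u(x)|^N |x|^{-t} dx. -/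
open MeasureTheory Real

/-- Surface area of the unit sphere `S^{N-1}` in `ℝ^N`, i.e. `ω_{N-1} = N · vol(B(0,1))`. -/
noncomputable def sphereArea (N : ℕ) : ℝ :=
  N * (volume (Metric.ball (0 : EuclideanSpace ℝ (Fin N)) 1)).toReal

/-- `Φ_N(τ) = Σ_{j ≥ N-1} τ^j / j!`, the exponential series with the first `N-1` terms removed. -/
noncomputable def PhiN (N : ℕ) (τ : ℝ) : ℝ :=
  ∑' j : ℕ, τ ^ (j + (N - 1)) / (Nat.factorial (j + (N - 1)) : ℝ)

/-- `g` is the weak gradient of `u` on `ℝ^N`: both are locally integrable and the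
integration-by-parts identity holds against all smooth compactly supported test functions. -/
def HasWeakGradient {N : ℕ} (u : EuclideanSpace ℝ (Fin N) → ℝ)
    (g : EuclideanSpace ℝ (Fin N) → EuclideanSpace ℝ (Fin N)) : Prop :=
  LocallyIntegrable u volume ∧ LocallyIntegrable g volume ∧
  ∀ φ : EuclideanSpace ℝ (Fin N) → ℝ, ContDiff ℝ (⊤ : ℕ∞) φ → HasCompactSupport φ →
    ∀ i : Fin N,
      ∫ x, u x * fderiv ℝ φ x (EuclideanSpace.single i 1) = - ∫ x, g x i * φ x

section

variable {N : ℕ}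

local notation "𝔼" => EuclideanSpace ℝ (Fin N)

section Polar

open Set Metric Measure
open scoped ENNReal

/-- Integration in polar coordinates for nonnegative functions. -/
theorem lintegral_eq_lintegral_toSphere [NeZero N] {F : 𝔼 → ℝ≥0∞} (hF : Measurable F) :
    ∫⁻ z, F z = ∫⁻ σ, (∫⁻ r in Ioi (0 : ℝ), ENNReal.ofReal (r ^ (N - 1)) * F (r • (σ : 𝔼)))
      ∂(volume : Measure 𝔼).toSphere := by
  have hdim : Module.finrank ℝ 𝔼 = N := by simp
  have : Nontrivial 𝔼 := by
    rw [← Module.finrank_pos_iff (R := ℝ), hdim]; exact Nat.pos_of_ne_zero (NeZero.ne N)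
  have h0 : MeasurableSet ({0}ᶜ : Set 𝔼) := (measurableSet_singleton _).compl
  have hcomp : Measurable fun p : sphere (0 : 𝔼) 1 × Ioi (0 : ℝ) ↦ F ((p.2 : ℝ) • (p.1 : 𝔼)) := by
    fun_prop
  calc ∫⁻ z, F z = ∫⁻ z in ({0}ᶜ : Set 𝔼), F z := by
        rw [restrict_compl_singleton]
    _ = ∫⁻ z : ({0}ᶜ : Set 𝔼), F z ∂((volume : Measure 𝔼).comap Subtype.val) := (lintegral_subtype_comap h0 _).symm
    _ = ∫⁻ p, F ((p.2 : ℝ) • (p.1 : 𝔼)) ∂((volume : Measure 𝔼).toSphere.prod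
          (volumeIoiPow (N - 1))) := by
        have := (volume : Measure 𝔼).measurePreserving_homeomorphUnitSphereProd
        rw [hdim] at this
        rw [← this.lintegral_comp hcomp]
        refine lintegral_congr fun z ↦ ?_
        congr 1
        have hz : ‖(z : 𝔼)‖ ≠ 0 := norm_ne_zero_iff.2 z.2
        simp [smul_smul, hz]
    _ = _ := by
        rw [lintegral_prod _ hcomp.aemeasurable]
        refine lintegral_congr fun σ ↦ ?_
        have hm : Measurable fun r : Ioi (0 : ℝ) ↦ F ((r : ℝ) • (σ : 𝔼)) := by fun_prop
        rw [volumeIoiPow, lintegral_withDensity_eq_lintegral_mul _ (by fun_prop) hm,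
          ← lintegral_subtype_comap measurableSet_Ioi]
        rfl

theorem toSphere_univ_eq_sphereArea :
    (volume : Measure 𝔼).toSphere univ = ENNReal.ofReal (sphereArea N) := by
  rw [toSphere_apply_univ, sphereArea, ENNReal.ofReal_mul (by positivity), ENNReal.ofReal_natCast,
    ENNReal.ofReal_toReal measure_ball_lt_top.ne]
  simp

theorem sphereArea_pos [NeZero N] : 0 < sphereArea N :=
  mul_pos (by exact_mod_cast Nat.pos_of_ne_zero (NeZero.ne N))
    (ENNReal.toReal_pos (measure_ball_pos _ _ one_pos).ne' measure_ball_lt_top.ne)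

/-- Integration of radial functions, with the integral on the half-line restricted to a set. -/
theorem setLIntegral_norm_eq_sphereArea_mul [NeZero N] {f : ℝ → ℝ≥0∞} (hf : Measurable f) {s : Set ℝ}
    (hs : MeasurableSet s) :
    ∫⁻ z in {z : 𝔼 | ‖z‖ ∈ s}, f ‖z‖ =
      ENNReal.ofReal (sphereArea N) * ∫⁻ r in s ∩ Ioi 0, ENNReal.ofReal (r ^ (N - 1)) * f r := by
  have hs' : MeasurableSet {z : 𝔼 | ‖z‖ ∈ s} := hs.preimage measurable_norm
  rw [← lintegral_indicator hs', lintegral_eq_lintegral_toSphere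
    (F := {z : 𝔼 | ‖z‖ ∈ s}.indicator fun z ↦ f ‖z‖)
    ((hf.comp measurable_norm).indicator hs'), mul_comm, ← toSphere_univ_eq_sphereArea,
    ← lintegral_const]
  refine lintegral_congr fun σ ↦ ?_
  rw [← setLIntegral_indicator hs]
  refine setLIntegral_congr_fun measurableSet_Ioi fun r hr ↦ ?_
  have : ‖r • (σ : 𝔼)‖ = r := by simp [norm_smul, abs_of_pos (mem_Ioi.1 hr)]
  by_cases h : r ∈ s <;> simp [indicator, this, h]

theorem lintegral_ball_norm_rpow_sub [NeZero N] {a R : ℝ} (ha : 0 < a) (hR : 0 ≤ R) :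
    ∫⁻ z in ball (0 : 𝔼) R, ENNReal.ofReal (‖z‖ ^ (a - N)) =
      ENNReal.ofReal (sphereArea N * (R ^ a / a)) := by
  have h1 : ball (0 : 𝔼) R = {z | ‖z‖ ∈ Iio R} := by ext; simp
  have hN : 1 ≤ N := Nat.pos_of_ne_zero (NeZero.ne N)
  rw [h1, setLIntegral_norm_eq_sphereArea_mul (f := fun r ↦ ENNReal.ofReal (r ^ (a - N)))
    (by fun_prop) measurableSet_Iio, ENNReal.ofReal_mul sphereArea_pos.le]
  congr 1
  have h2 : ∫⁻ r in Iio R ∩ Ioi 0, ENNReal.ofReal (r ^ (N - 1)) * ENNReal.ofReal (r ^ (a - N)) =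
      ∫⁻ r in Ioc 0 R, ENNReal.ofReal (r ^ (a - 1)) := by
    rw [inter_comm, Ioi_inter_Iio, ← restrict_congr_set Ioo_ae_eq_Ioc]
    refine setLIntegral_congr_fun measurableSet_Ioo fun r hr ↦ ?_
    rw [← ENNReal.ofReal_mul (by have := hr.1; positivity), ← rpow_natCast, ← rpow_add hr.1]
    congr 2; push_cast [hN]; ring
  rw [h2, ← ofReal_integral_eq_lintegral_ofReal, ← intervalIntegral.integral_of_le hR,
    integral_rpow (Or.inl (by linarith))]
  · simp [ha.ne']
  · exact (intervalIntegrable_iff_integrableOn_Ioc_of_le hR).1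
      (intervalIntegral.intervalIntegrable_rpow' (by linarith))
  · filter_upwards [ae_restrict_mem measurableSet_Ioc] with r hr
    exact rpow_nonneg hr.1.le _

theorem lintegral_annulus_norm_rpow_neg [NeZero N] {δ R : ℝ} (hδ : 0 < δ) (hR : δ ≤ R) :
    ∫⁻ z in {z : 𝔼 | ‖z‖ ∈ Ico δ R}, ENNReal.ofReal (‖z‖ ^ (-N : ℝ)) =
      ENNReal.ofReal (sphereArea N * log (R / δ)) := by
  have hN : 1 ≤ N := Nat.pos_of_ne_zero (NeZero.ne N)
  rw [setLIntegral_norm_eq_sphereArea_mul (f := fun r ↦ ENNReal.ofReal (r ^ (-N : ℝ)))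
    (by fun_prop) measurableSet_Ico, ENNReal.ofReal_mul sphereArea_pos.le]
  congr 1
  have h2 : ∫⁻ r in Ico δ R ∩ Ioi 0, ENNReal.ofReal (r ^ (N - 1)) * ENNReal.ofReal (r ^ (-N : ℝ)) =
      ∫⁻ r in Ioc δ R, ENNReal.ofReal (r⁻¹) := by
    rw [inter_eq_left.2 (show Ico δ R ⊆ Ioi 0 from fun x hx ↦ hδ.trans_le hx.1), ← restrict_congr_set Ico_ae_eq_Ioc]
    refine setLIntegral_congr_fun measurableSet_Ico fun r hr ↦ ?_
    have hr0 : 0 < r := hδ.trans_le hr.1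
    rw [← ENNReal.ofReal_mul (by positivity), ← rpow_natCast, ← rpow_add hr0, ← rpow_neg_one]
    congr 2; push_cast [hN]; ring
  rw [h2, ← ofReal_integral_eq_lintegral_ofReal, ← intervalIntegral.integral_of_le hR,
    integral_inv_of_pos hδ (hδ.trans_le hR)]
  · refine (intervalIntegrable_iff_integrableOn_Ioc_of_le hR).1
      (intervalIntegral.intervalIntegrable_inv (fun x hx ↦ ?_) continuousOn_id)
    rw [uIcc_of_le hR] at hx
    exact (hδ.trans_le hx.1).ne'
  · filter_upwards [ae_restrict_mem measurableSet_Ioc] with r hr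
    exact inv_nonneg.2 (hδ.trans hr.1).le

end Polar

section Representation

open Set Metric Measure
open scoped ENNReal

/-- The excess of `|h|` over level `1` at the origin is controlled by the variation of `h` before
the first time at which `|h| ≤ 1`. -/
theorem ofReal_abs_sub_one_le_lintegral_deriv {h : ℝ → ℝ} (hh : ContDiff ℝ 1 h)
    (hexit : ∃ r, 0 < r ∧ |h r| ≤ 1) :
    ENNReal.ofReal (|h 0| - 1) ≤ ∫⁻ r in Ioi (0 : ℝ), {r | 1 < |h r|}.indicator (‖deriv h ·‖ₑ) r := by
  have hA : MeasurableSet {r | 1 < |h r|} :=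
    (isOpen_lt continuous_const hh.continuous.abs).measurableSet
  set S : Set ℝ := {r | 0 ≤ r ∧ |h r| ≤ 1} with hS
  have hSc : IsClosed S := (isClosed_le continuous_const continuous_id).inter
    (isClosed_le hh.continuous.abs continuous_const)
  have hSn : S.Nonempty := by
    obtain ⟨r, hr, h1⟩ := hexit
    exact ⟨r, hr.le, h1⟩
  have hSb : BddBelow S := ⟨0, fun r hr ↦ hr.1⟩
  set T := sInf S with hT
  obtain ⟨hT0, hT1⟩ : T ∈ S := hSc.csInf_mem hSn hSb
  have hlt : ∀ r ∈ Ioo 0 T, 1 < |h r| := by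
    intro r hr
    by_contra! hc
    exact absurd (csInf_le hSb ⟨hr.1.le, hc⟩) (not_le.2 hr.2)
  have hcd : Continuous (deriv h) := hh.continuous_deriv le_rfl
  calc ENNReal.ofReal (|h 0| - 1) ≤ ENNReal.ofReal ‖h T - h 0‖ := by
        refine ENNReal.ofReal_le_ofReal ?_
        have := abs_sub_abs_le_abs_sub (h 0) (h T)
        rw [Real.norm_eq_abs, abs_sub_comm]
        linarith
    _ = ‖∫ r in (0 : ℝ)..T, deriv h r‖ₑ := by
        rw [intervalIntegral.integral_deriv_eq_sub
          (fun x _ ↦ (hh.differentiable one_ne_zero) x) (hcd.intervalIntegrable _ _),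
          ofReal_norm]
    _ ≤ ∫⁻ r in Ioc 0 T, ‖deriv h r‖ₑ := by
        rw [intervalIntegral.integral_of_le hT0]
        exact enorm_integral_le_lintegral_enorm _
    _ = ∫⁻ r in Ioo 0 T, {r | 1 < |h r|}.indicator (‖deriv h ·‖ₑ) r := by
        rw [← restrict_congr_set Ioo_ae_eq_Ioc]
        refine setLIntegral_congr_fun measurableSet_Ioo fun r hr ↦ ?_
        exact (indicator_of_mem (s := {r | 1 < |h r|}) (hlt r hr) (‖deriv h ·‖ₑ)).symm
    _ ≤ _ := lintegral_mono_set fun r hr ↦ hr.1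

theorem lintegral_Ioi_inv_eq_top (a : ℝ) : ∫⁻ r in Ioi a, ENNReal.ofReal r⁻¹ = ∞ := by
  wlog ha : 0 < a generalizing a
  · exact top_le_iff.1 ((this 1 one_pos).symm.le.trans
      (lintegral_mono_set (Ioi_subset_Ioi (by linarith))))
  by_contra hne
  refine not_integrableOn_Ioi_inv (a := a) ?_
  refine ⟨by fun_prop, ?_⟩
  rw [HasFiniteIntegral]
  refine lt_of_le_of_lt (le_of_eq ?_) (lt_top_iff_ne_top.2 hne)
  refine setLIntegral_congr_fun measurableSet_Ioi fun r hr ↦ ?_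
  rw [Real.enorm_of_nonneg]
  exact inv_nonneg.2 (ha.trans hr).le

theorem lintegral_ray_norm_rpow_neg_eq_top [NeZero N] {t : ℝ} (ht0 : 0 ≤ t) (htN : t < N)
    (x σ : 𝔼) (hσ : ‖σ‖ = 1) :
    ∫⁻ r in Ioi (0 : ℝ), ENNReal.ofReal (r ^ (N - 1)) * ENNReal.ofReal (‖x + r • σ‖ ^ (-t)) = ∞ := by
  have hN : 1 ≤ N := Nat.pos_of_ne_zero (NeZero.ne N)
  rw [← top_le_iff]
  calc ∞ = ENNReal.ofReal (2 ^ (-t)) * ∫⁻ r in Ioi (max 1 ‖x‖), ENNReal.ofReal r⁻¹ := by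
        rw [lintegral_Ioi_inv_eq_top, ENNReal.mul_top]
        simp only [ne_eq, ENNReal.ofReal_eq_zero, not_le]
        positivity
    _ = ∫⁻ r in Ioi (max 1 ‖x‖), ENNReal.ofReal (2 ^ (-t)) * ENNReal.ofReal r⁻¹ :=
        (lintegral_const_mul _ (by fun_prop)).symm
    _ ≤ ∫⁻ r in Ioi (max 1 ‖x‖),
          ENNReal.ofReal (r ^ (N - 1)) * ENNReal.ofReal (‖x + r • σ‖ ^ (-t)) := by
        refine setLIntegral_mono' measurableSet_Ioi fun r hr ↦ ?_
        have hr1 : 1 < r := (le_max_left _ _).trans_lt hr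
        have hrx : ‖x‖ < r := (le_max_right _ _).trans_lt hr
        have hr0 : 0 < r := by linarith
        have hrσ : ‖r • σ‖ = r := by rw [norm_smul, hσ, mul_one, Real.norm_of_nonneg hr0.le]
        have hpos : 0 < ‖x + r • σ‖ := by
          have := norm_sub_norm_le (r • σ) (-x)
          rw [norm_neg, hrσ, sub_neg_eq_add, add_comm] at this
          linarith
        have hle : ‖x + r • σ‖ ≤ 2 * r := by
          have := norm_add_le x (r • σ)
          linarith
        rw [← ENNReal.ofReal_mul (by positivity), ← ENNReal.ofReal_mul (by positivity)]
        refine ENNReal.ofReal_le_ofReal ?_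
        calc 2 ^ (-t) * r⁻¹ ≤ 2 ^ (-t) * r ^ ((N : ℝ) - 1 - t) := by
              rw [← rpow_neg_one]
              gcongr
              · exact hr1.le
              · linarith
          _ = r ^ (N - 1) * (2 * r) ^ (-t) := by
              rw [mul_rpow (by norm_num) hr0.le, ← rpow_natCast, mul_left_comm, ← rpow_add hr0]
              congr 2; push_cast [hN]; ring
          _ ≤ _ := by
              gcongr ?_ * ?_
              exact rpow_le_rpow_of_nonpos hpos hle (by linarith)
    _ ≤ _ := lintegral_mono_set fun r hr ↦ mem_Ioi.2 (by
        have := (le_max_left 1 ‖x‖).trans_lt hr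
        linarith)

/-- Potential estimate for the excess of a `C¹` function over level `1`, in terms of its
gradient on the superlevel set. -/
theorem ofReal_sphereArea_mul_le_potential [NeZero N] {t : ℝ} (ht0 : 0 ≤ t) (htN : t < N)
    {w : 𝔼 → ℝ} (hw : ContDiff ℝ 1 w)
    (hA : ∫⁻ y in {y | 1 < |w y|}, ENNReal.ofReal (‖y‖ ^ (-t)) ≠ ∞) (x : 𝔼) :
    ENNReal.ofReal (sphereArea N) * ENNReal.ofReal (|w x| - 1) ≤
      ∫⁻ y in {y | 1 < |w y|}, ‖fderiv ℝ w y‖ₑ * ENNReal.ofReal (‖x - y‖ ^ (1 - N : ℝ)) := by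
  have hN : 1 ≤ N := Nat.pos_of_ne_zero (NeZero.ne N)
  set A : Set 𝔼 := {y | 1 < |w y|} with hAdef
  have hAm : MeasurableSet A := (isOpen_lt continuous_const hw.continuous.abs).measurableSet
  have hdw : Measurable fun y ↦ ‖fderiv ℝ w y‖ₑ := (hw.continuous_fderiv one_ne_zero).enorm.measurable
  -- almost every ray from `x` leaves `A`
  have hexit : ∀ᵐ σ : sphere (0 : 𝔼) 1 ∂(volume : Measure 𝔼).toSphere,
      ∃ r : ℝ, 0 < r ∧ |w (x + r • (σ : 𝔼))| ≤ 1 := by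
    set F : 𝔼 → ℝ≥0∞ := fun z ↦ A.indicator (fun y ↦ ENNReal.ofReal (‖y‖ ^ (-t))) (x + z) with hF
    have hFm : Measurable F :=
      (Measurable.indicator (by fun_prop) hAm).comp (measurable_const_add x)
    have h1 : ∫⁻ z, F z ≠ ∞ := by
      rw [hF, lintegral_add_left_eq_self (fun y ↦ A.indicator
        (fun y ↦ ENNReal.ofReal (‖y‖ ^ (-t))) y) x, lintegral_indicator hAm]
      exact hA
    rw [lintegral_eq_lintegral_toSphere hFm] at h1
    have hm : Measurable fun σ : sphere (0 : 𝔼) 1 ↦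
        ∫⁻ r in Ioi (0 : ℝ), ENNReal.ofReal (r ^ (N - 1)) * F (r • (σ : 𝔼)) :=
      Measurable.lintegral_prod_right' (f := fun p : sphere (0 : 𝔼) 1 × ℝ ↦
        ENNReal.ofReal (p.2 ^ (N - 1)) * F (p.2 • (p.1 : 𝔼))) (by fun_prop)
    filter_upwards [ae_lt_top hm h1] with σ hσ
    by_contra! hc
    refine hσ.ne ?_
    rw [← lintegral_ray_norm_rpow_neg_eq_top ht0 htN x (σ : 𝔼) (by simp)]
    refine setLIntegral_congr_fun measurableSet_Ioi fun r hr ↦ ?_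
    have : x + r • (σ : 𝔼) ∈ A := hc r hr
    simp [hF, this]
  set G : 𝔼 → ℝ≥0∞ := fun y ↦ A.indicator (fun y ↦ ‖fderiv ℝ w y‖ₑ *
    ENNReal.ofReal (‖x - y‖ ^ (1 - N : ℝ))) y with hG
  have hGm : Measurable G := Measurable.indicator (by fun_prop) hAm
  rw [← lintegral_indicator hAm, ← lintegral_add_left_eq_self _ x,
    lintegral_eq_lintegral_toSphere (F := fun z ↦ G (x + z)) (by fun_prop), mul_comm,
    ← toSphere_univ_eq_sphereArea, ← lintegral_const]
  refine lintegral_mono_ae ?_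
  filter_upwards [hexit] with σ hσ
  set h : ℝ → ℝ := fun r ↦ w (x + r • (σ : 𝔼)) with hh
  have hhc : ContDiff ℝ 1 h := by fun_prop
  have h0 : |w x| = |h 0| := by simp [hh]
  rw [h0]
  refine (ofReal_abs_sub_one_le_lintegral_deriv hhc hσ).trans ?_
  refine setLIntegral_mono' measurableSet_Ioi fun r hr ↦ ?_
  have hr0 : 0 < r := hr
  by_cases hrA : x + r • (σ : 𝔼) ∈ A
  · have hrA' : r ∈ {r | 1 < |h r|} := hrA
    have hn : ‖r • (σ : 𝔼)‖ = r := by simp [norm_smul, abs_of_pos hr0]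
    have hder : HasDerivAt h (fderiv ℝ w (x + r • (σ : 𝔼)) σ) r := by
      have h1 : HasDerivAt (fun r : ℝ ↦ x + r • (σ : 𝔼)) (σ : 𝔼) r := by
        simpa using ((hasDerivAt_id r).smul_const (σ : 𝔼)).const_add x
      exact ((hw.differentiable one_ne_zero _).hasFDerivAt).comp_hasDerivAt r h1
    rw [indicator_of_mem hrA', hG]
    simp only [indicator_of_mem hrA, sub_add_cancel_left, norm_neg, hn]
    rw [hder.deriv, mul_left_comm, ← ENNReal.ofReal_mul (by positivity), ← rpow_natCast,
      ← rpow_add hr0, Nat.cast_sub hN]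
    simp only [Nat.cast_one, sub_add_sub_cancel, sub_self, rpow_zero, ENNReal.ofReal_one, mul_one]
    calc _ ≤ ‖fderiv ℝ w (x + r • (σ : 𝔼))‖ₑ * ‖(σ : 𝔼)‖ₑ := ContinuousLinearMap.le_opENorm _ _
      _ = _ := by rw [← ofReal_norm (σ : 𝔼)]; simp
  · have hrA' : r ∉ {r | 1 < |h r|} := hrA
    rw [indicator_of_notMem hrA']
    exact zero_le

end Representation

section Kernel

open Set Metric Measure
open scoped ENNReal

/-- `(1 + s) ^ p` is bounded by `(1 + ε) * s ^ p` up to an additive constant. -/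
theorem exists_one_add_rpow_le {p ε : ℝ} (hp : 1 < p) (hε : 0 < ε) :
    ∃ C : ℝ, 0 ≤ C ∧ ∀ s : ℝ, 0 ≤ s → (1 + s) ^ p ≤ (1 + ε) * s ^ p + C := by
  set l : ℝ := (1 + ε) ^ (-(1 / (p - 1))) with hl
  have hp1 : 0 < p - 1 := by linarith
  have hl0 : 0 < l := by positivity
  have hl1 : l < 1 := rpow_lt_one_of_one_lt_of_neg (by linarith) (by rw [neg_lt_zero]; positivity)
  have h1l : 0 < 1 - l := by linarith
  have hll : l * l⁻¹ ^ p = 1 + ε := by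
    rw [inv_rpow hl0.le, ← rpow_neg hl0.le]
    nth_rewrite 1 [← rpow_one l]
    rw [← rpow_add hl0, hl, ← rpow_mul (by linarith)]
    have : -(1 / (p - 1)) * (1 + -p) = 1 := by field_simp; ring
    rw [this, rpow_one]
  refine ⟨(1 - l) * (1 - l)⁻¹ ^ p, by positivity, fun s hs ↦ ?_⟩
  have := (convexOn_rpow hp.le).2 (x := l⁻¹ * s) (mem_Ici.2 (by positivity)) (y := (1 - l)⁻¹)
    (mem_Ici.2 (by positivity)) hl0.le h1l.le (by ring)
  simp only [smul_eq_mul] at this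
  rw [mul_inv_cancel_left₀ hl0.ne', mul_inv_cancel₀ h1l.ne', mul_rpow (by positivity) hs,
    ← mul_assoc, hll, add_comm s] at this
  exact this

/-- Jensen's inequality for a nonnegative kernel of finite mass. -/
theorem lintegral_mul_rpow_le {X : Type*} [MeasurableSpace X] {μ : Measure X} {p : ℝ} (hp : 1 < p)
    {f k : X → ℝ≥0∞} (hf : AEMeasurable f μ) (hk : AEMeasurable k μ) :
    (∫⁻ x, f x * k x ∂μ) ^ p ≤ (∫⁻ x, k x ∂μ) ^ (p - 1) * ∫⁻ x, f x ^ p * k x ∂μ := by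
  have hp0 : 0 < p := by linarith
  have hpq := Real.HolderConjugate.conjExponent hp
  set q := p.conjExponent with hq
  have hq0 : 0 < q := hpq.symm.pos
  have h1 : ∀ x, f x * k x = (f x * k x ^ (1 / p)) * k x ^ (1 / q) := fun x ↦ by
    rw [mul_assoc, ← ENNReal.rpow_add_of_nonneg _ _ (by positivity) (by positivity)]
    rw [one_div, one_div, hpq.inv_add_inv_eq_one, ENNReal.rpow_one]
  simp_rw [h1]
  calc _ ≤ ((∫⁻ x, (f x * k x ^ (1 / p)) ^ p ∂μ) ^ (1 / p) *
          (∫⁻ x, (k x ^ (1 / q)) ^ q ∂μ) ^ (1 / q)) ^ p := by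
        gcongr
        exact ENNReal.lintegral_mul_le_Lp_mul_Lq μ hpq (by fun_prop) (by fun_prop)
    _ = (∫⁻ x, f x ^ p * k x ∂μ) * (∫⁻ x, k x ∂μ) ^ (p - 1) := by
        rw [ENNReal.mul_rpow_of_nonneg _ _ hp0.le, ← ENNReal.rpow_mul, ← ENNReal.rpow_mul,
          one_div_mul_cancel hp0.ne', ENNReal.rpow_one]
        simp_rw [ENNReal.mul_rpow_of_nonneg _ _ hp0.le, ← ENNReal.rpow_mul,
          one_div_mul_cancel hp0.ne', one_div_mul_cancel hq0.ne', ENNReal.rpow_one]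
        congr 2
        have hp1 : p - 1 ≠ 0 := by linarith
        rw [hq, Real.conjExponent]
        field_simp
    _ = _ := mul_comm _ _

/-- The scale on which a set of bounded weighted volume `‖y‖ ^ (-t)` is localized near `x`. -/
noncomputable def weightScale (t : ℝ) (x : 𝔼) : ℝ := (1 + ‖x‖) ^ (t / N) / 2

theorem weightScale_pos (t : ℝ) (x : 𝔼) : 0 < weightScale t x := by
  unfold weightScale; positivity

theorem continuous_weightScale (t : ℝ) : Continuous (weightScale t : 𝔼 → ℝ) := by
  unfold weightScale
  refine Continuous.div_const (Continuous.rpow_const (by fun_prop) fun x ↦ Or.inl ?_) _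
  positivity

theorem weightScale_le_two_mul [NeZero N] {t : ℝ} (ht0 : 0 ≤ t) (htN : t < N) {x y : 𝔼}
    (h : ‖x‖ ≤ 1 + 2 * ‖y‖) : weightScale t x ≤ 2 * weightScale t y := by
  have hN : (0 : ℝ) < N := by exact_mod_cast Nat.pos_of_ne_zero (NeZero.ne N)
  unfold weightScale
  have h1 : (1 + ‖x‖) ^ (t / N) ≤ (2 * (1 + ‖y‖)) ^ (t / N) := by
    gcongr; linarith
  have h2 : (2 : ℝ) ^ (t / N) ≤ 2 := by
    nth_rewrite 2 [← rpow_one 2]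
    gcongr
    · norm_num
    · rw [div_le_one hN]; exact htN.le
  rw [mul_rpow (by norm_num) (by positivity)] at h1
  have h3 : (0 : ℝ) ≤ (1 + ‖y‖) ^ (t / N) := by positivity
  nlinarith [mul_le_mul_of_nonneg_right h2 h3]

theorem weightScale_le [NeZero N] {t : ℝ} (htN : t < N) (x : 𝔼) :
    weightScale t x ≤ (1 + ‖x‖) / 2 := by
  have hN : (0 : ℝ) < N := by exact_mod_cast Nat.pos_of_ne_zero (NeZero.ne N)
  unfold weightScale
  gcongr
  nth_rewrite 2 [← rpow_one (1 + ‖x‖)]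
  gcongr
  · linarith [norm_nonneg x]
  · rw [div_le_one hN]; exact htN.le

theorem rpow_neg_le_of_weightScale_le [NeZero N] {t : ℝ} (ht0 : 0 ≤ t) (htN : t < N) {x y : 𝔼}
    (hy : y ≠ 0) (h : weightScale t x ≤ ‖x - y‖) :
    ‖x - y‖ ^ (-N : ℝ) ≤ 4 ^ N * ‖y‖ ^ (-t) := by
  have hN : (0 : ℝ) < N := by exact_mod_cast Nat.pos_of_ne_zero (NeZero.ne N)
  set d := ‖x - y‖ with hd
  have hd0 : 0 < d := (weightScale_pos t x).trans_le h
  have h2d : (1 + ‖x‖) ^ (t / N) ≤ 2 * d := by unfold weightScale at h; linarith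
  have h2d1 : 1 ≤ 2 * d := (one_le_rpow (by linarith [norm_nonneg x]) (by positivity)).trans h2d
  have hx : (1 + ‖x‖) ^ t ≤ (2 * d) ^ (N : ℝ) := by
    calc (1 + ‖x‖) ^ t = ((1 + ‖x‖) ^ (t / N)) ^ (N : ℝ) := by
          rw [← rpow_mul (by positivity), div_mul_cancel₀ _ hN.ne']
      _ ≤ _ := by gcongr
  have hdt : (2 * d) ^ t ≤ (2 * d) ^ (N : ℝ) := rpow_le_rpow_of_exponent_le h2d1 htN.le
  have hyle : ‖y‖ ≤ 2 * max (1 + ‖x‖) (2 * d) := by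
    have h1 : ‖y‖ ≤ ‖x‖ + d := by
      rw [hd, norm_sub_rev]
      simpa using norm_add_le x (y - x)
    have := le_max_left (1 + ‖x‖) (2 * d)
    have := le_max_right (1 + ‖x‖) (2 * d)
    linarith
  have hyt : ‖y‖ ^ t ≤ 4 ^ N * d ^ (N : ℝ) := by
    calc ‖y‖ ^ t ≤ (2 * max (1 + ‖x‖) (2 * d)) ^ t := by gcongr
      _ = 2 ^ t * (max (1 + ‖x‖) (2 * d)) ^ t := mul_rpow (by norm_num) (by positivity)
      _ ≤ 2 ^ (N : ℝ) * (2 * d) ^ (N : ℝ) := by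
          gcongr ?_ * ?_
          · exact rpow_le_rpow_of_exponent_le (by norm_num) htN.le
          · rcases max_cases (1 + ‖x‖) (2 * d) with hm | hm <;> rw [hm.1] <;> assumption
      _ = 4 ^ N * d ^ (N : ℝ) := by
          rw [mul_rpow (by norm_num) hd0.le, ← mul_assoc, ← mul_rpow (by norm_num) (by norm_num),
            rpow_natCast (2 * 2)]
          norm_num
  have hy0 : 0 < ‖y‖ := norm_pos_iff.2 hy
  rw [rpow_neg hd0.le, rpow_neg hy0.le, ← div_eq_mul_inv, inv_eq_one_div, div_le_div_iff₀
    (by positivity) (by positivity), one_mul]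
  exact hyt

/-- Logarithmic bound for the critical kernel away from its singularity, on a set of weighted volume
at most one. -/
theorem lintegral_far_kernel_le [NeZero N] {t : ℝ} (ht0 : 0 ≤ t) (htN : t < N) {A : Set 𝔼}
    (hAm : MeasurableSet A) (hA : ∫⁻ y in A, ENNReal.ofReal (‖y‖ ^ (-t)) ≤ 1) (x : 𝔼) {δ : ℝ}
    (hδ : 0 < δ) (hδr : δ ≤ weightScale t x) :
    ∫⁻ y in A ∩ (ball x δ)ᶜ, ENNReal.ofReal (‖x - y‖ ^ (-N : ℝ)) ≤
      ENNReal.ofReal (sphereArea N * log (weightScale t x / δ) + 4 ^ N) := by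
  set R := weightScale t x with hR
  have hlog : 0 ≤ log (R / δ) := log_nonneg ((one_le_div hδ).2 hδr)
  have hsub : A ∩ (ball x δ)ᶜ ⊆ {y | ‖x - y‖ ∈ Ico δ R} ∪ (A ∩ {y | R ≤ ‖x - y‖}) := by
    intro y hy
    have h1 : δ ≤ ‖x - y‖ := by simpa [dist_eq_norm_sub'] using hy.2
    rcases lt_or_ge ‖x - y‖ R with h | h
    · exact Or.inl ⟨h1, h⟩
    · exact Or.inr ⟨hy.1, h⟩
  have h1 : ∫⁻ y in {y | ‖x - y‖ ∈ Ico δ R}, ENNReal.ofReal (‖x - y‖ ^ (-N : ℝ)) =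
      ENNReal.ofReal (sphereArea N * log (R / δ)) := by
    have hm : MeasurableSet {z : 𝔼 | ‖z‖ ∈ Ico δ R} := measurableSet_Ico.preimage measurable_norm
    have hm' : MeasurableSet {y : 𝔼 | ‖x - y‖ ∈ Ico δ R} := hm.preimage (measurable_const_sub x)
    rw [← lintegral_annulus_norm_rpow_neg hδ hδr, ← lintegral_indicator hm,
      ← lintegral_indicator hm', ← lintegral_sub_left_eq_self _ x]
    simp [indicator]
  have hm2 : MeasurableSet {y | R ≤ ‖x - y‖} := measurableSet_le (by fun_prop) (by fun_prop)
  have h2 : ∫⁻ y in A ∩ {y | R ≤ ‖x - y‖}, ENNReal.ofReal (‖x - y‖ ^ (-N : ℝ)) ≤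
      ENNReal.ofReal (4 ^ N) := by
    have hne : ∀ᵐ y : 𝔼, y ≠ 0 := by
      have : Nontrivial 𝔼 := by
        rw [← Module.finrank_pos_iff (R := ℝ), finrank_euclideanSpace_fin]
        exact Nat.pos_of_ne_zero (NeZero.ne N)
      simp [ae_iff]
    calc _ ≤ ∫⁻ y in A ∩ {y | R ≤ ‖x - y‖}, ENNReal.ofReal (4 ^ N) * ENNReal.ofReal (‖y‖ ^ (-t)) := by
          refine setLIntegral_mono_ae' (hAm.inter hm2) ?_
          filter_upwards [hne] with y hy hyA
          rw [← ENNReal.ofReal_mul (by positivity)]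
          exact ENNReal.ofReal_le_ofReal (rpow_neg_le_of_weightScale_le ht0 htN hy hyA.2)
      _ ≤ ENNReal.ofReal (4 ^ N) * ∫⁻ y in A, ENNReal.ofReal (‖y‖ ^ (-t)) := by
          rw [lintegral_const_mul _ (by fun_prop)]
          gcongr
          exact inter_subset_left
      _ ≤ _ := mul_le_of_le_one_right' hA
  calc _ ≤ _ := lintegral_mono_set hsub
    _ ≤ _ := lintegral_union_le _ _ _
    _ ≤ _ := by
      rw [h1, ENNReal.ofReal_add (mul_nonneg sphereArea_pos.le hlog) (by positivity)]
      gcongr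

/-- Truncated Riesz kernel of order `a` with the variable truncation radius `weightScale t x`,
normalized to constant mass in the second variable. -/
noncomputable def localKernel (t a : ℝ) (x y : 𝔼) : ℝ≥0∞ :=
  ENNReal.ofReal (weightScale t x ^ (-a)) *
    (ball x (weightScale t x)).indicator (fun y ↦ ENNReal.ofReal (‖x - y‖ ^ (a - N))) y

theorem measurable_localKernel (t a : ℝ) :
    Measurable fun p : 𝔼 × 𝔼 ↦ localKernel t a p.1 p.2 := by
  have hc := (continuous_weightScale (N := N) t).measurable
  have hs : MeasurableSet {p : 𝔼 × 𝔼 | dist p.2 p.1 < weightScale t p.1} :=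
    measurableSet_lt (by fun_prop) (by fun_prop)
  unfold localKernel
  refine Measurable.mul (by fun_prop) ?_
  exact Measurable.indicator (f := fun p : 𝔼 × 𝔼 ↦ ENNReal.ofReal (‖p.1 - p.2‖ ^ (a - N)))
    (by fun_prop) hs

theorem lintegral_indicator_ball_norm_sub_rpow [NeZero N] {a R : ℝ} (ha : 0 < a) (hR : 0 ≤ R)
    (x : 𝔼) :
    ∫⁻ y, (ball x R).indicator (fun y ↦ ENNReal.ofReal (‖x - y‖ ^ (a - N))) y =
      ENNReal.ofReal (sphereArea N * (R ^ a / a)) := by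
  rw [← lintegral_ball_norm_rpow_sub ha hR, ← lintegral_indicator measurableSet_ball,
    ← lintegral_sub_left_eq_self _ x]
  refine lintegral_congr fun y ↦ ?_
  simp [indicator, dist_eq_norm_sub']

theorem lintegral_localKernel_right [NeZero N] {t a : ℝ} (ha : 0 < a) (x : 𝔼) :
    ∫⁻ y, localKernel t a x y = ENNReal.ofReal (sphereArea N / a) := by
  have hr := weightScale_pos t x
  unfold localKernel
  rw [lintegral_const_mul _ (Measurable.indicator (by fun_prop) measurableSet_ball),
    lintegral_indicator_ball_norm_sub_rpow ha hr.le, ← ENNReal.ofReal_mul (by positivity)]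
  congr 1
  rw [rpow_neg hr.le]
  field_simp

theorem lintegral_localKernel_left_le [NeZero N] {t a : ℝ} (ht0 : 0 ≤ t) (htN : t < N) (ha : 0 < a)
    (y : 𝔼) :
    ∫⁻ x, localKernel t a x y ≤ ENNReal.ofReal (4 ^ a * (sphereArea N / a)) := by
  have hr := weightScale_pos t y
  calc ∫⁻ x, localKernel t a x y ≤ ∫⁻ x, ENNReal.ofReal ((weightScale t y / 2) ^ (-a)) *
        (ball y (2 * weightScale t y)).indicator (fun x ↦ ENNReal.ofReal (‖y - x‖ ^ (a - N))) x := by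
        refine lintegral_mono fun x ↦ ?_
        unfold localKernel
        by_cases hxy : y ∈ ball x (weightScale t x)
        · have hd : ‖x - y‖ < weightScale t x := by simpa [dist_eq_norm_sub'] using hxy
          have hle := weightScale_le htN x
          have h1 : ‖x‖ ≤ ‖y‖ + ‖x - y‖ := by simpa using norm_add_le y (x - y)
          have h2 : ‖y‖ ≤ ‖x‖ + ‖x - y‖ := by
            rw [norm_sub_rev]; simpa using norm_add_le x (y - x)
          have h3 : weightScale t x ≤ 2 * weightScale t y :=
            weightScale_le_two_mul ht0 htN (by linarith)
          have h4 : weightScale t y ≤ 2 * weightScale t x :=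
            weightScale_le_two_mul ht0 htN (by linarith [norm_nonneg x])
          have hx : x ∈ ball y (2 * weightScale t y) := by
            rw [mem_ball, dist_eq_norm_sub]; linarith
          rw [indicator_of_mem hxy, indicator_of_mem hx, norm_sub_rev]
          gcongr ENNReal.ofReal ?_ * _
          exact rpow_le_rpow_of_nonpos (by positivity) (by linarith) (by linarith)
        · simp [indicator_of_notMem hxy]
    _ = ENNReal.ofReal (4 ^ a * (sphereArea N / a)) := by
        rw [lintegral_const_mul _ (Measurable.indicator (by fun_prop) measurableSet_ball),
          lintegral_indicator_ball_norm_sub_rpow ha (by positivity),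
          ← ENNReal.ofReal_mul (by positivity)]
        congr 1
        rw [rpow_neg (by positivity), div_rpow hr.le (by norm_num), mul_rpow (by norm_num) hr.le,
          show (4 : ℝ) = 2 * 2 by norm_num, mul_rpow (by norm_num) (by norm_num)]
        field_simp

/-- Schur's test for `localKernel`. -/
theorem lintegral_localKernel_rpow_le [NeZero N] {t a p : ℝ} (ht0 : 0 ≤ t) (htN : t < N)
    (ha : 0 < a) (hp : 1 < p) {f : 𝔼 → ℝ≥0∞} (hf : Measurable f) (hf1 : ∫⁻ y, f y ^ p ≤ 1) :
    ∫⁻ x, (∫⁻ y, f y * localKernel t a x y) ^ p ≤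
      ENNReal.ofReal (sphereArea N / a) ^ (p - 1) * ENNReal.ofReal (4 ^ a * (sphereArea N / a)) := by
  have hk := measurable_localKernel (N := N) t a
  have hkx : ∀ x : 𝔼, Measurable (localKernel t a x) := fun x ↦
    Measurable.of_uncurry_left (f := localKernel t a) hk
  have hky : ∀ y : 𝔼, Measurable fun x ↦ localKernel t a x y := fun y ↦
    Measurable.of_uncurry_right (f := localKernel t a) hk
  have hfp : Measurable fun y ↦ f y ^ p := hf.pow_const p
  have hfk : Measurable fun z : 𝔼 × 𝔼 ↦ f z.2 ^ p * localKernel t a z.1 z.2 :=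
    (hfp.comp measurable_snd).mul hk
  calc ∫⁻ x, (∫⁻ y, f y * localKernel t a x y) ^ p
      ≤ ∫⁻ x, ENNReal.ofReal (sphereArea N / a) ^ (p - 1) * ∫⁻ y, f y ^ p * localKernel t a x y := by
        refine lintegral_mono fun x ↦ ?_
        simp only
        rw [← lintegral_localKernel_right (t := t) ha x]
        exact lintegral_mul_rpow_le hp hf.aemeasurable (hkx x).aemeasurable
    _ = ENNReal.ofReal (sphereArea N / a) ^ (p - 1) *
          ∫⁻ x, ∫⁻ y, f y ^ p * localKernel t a x y :=
        lintegral_const_mul _ hfk.lintegral_prod_right'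
    _ = ENNReal.ofReal (sphereArea N / a) ^ (p - 1) *
          ∫⁻ y, f y ^ p * ∫⁻ x, localKernel t a x y := by
        rw [lintegral_lintegral_swap hfk.aemeasurable]
        congr 1
        exact lintegral_congr fun y ↦ lintegral_const_mul _ (hky y)
    _ ≤ ENNReal.ofReal (sphereArea N / a) ^ (p - 1) *
          ∫⁻ y, f y ^ p * ENNReal.ofReal (4 ^ a * (sphereArea N / a)) := by
        refine mul_le_mul_right (lintegral_mono fun y ↦ ?_) _
        exact mul_le_mul_right (lintegral_localKernel_left_le ht0 htN ha y) _
    _ ≤ _ := by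
        rw [lintegral_mul_const _ hfp]
        exact mul_le_mul_right (mul_le_of_le_one_left' hf1) _

end Kernel

section Superlevel

open Set Metric Measure
open scoped ENNReal

/-- Splitting the Riesz potential at the distance `θ * weightScale t x`. -/
theorem potential_le_localKernel_add_log (hN : 2 ≤ N) {t a θ : ℝ} (ht0 : 0 ≤ t) (htN : t < N)
    (ha1 : a < 1) (hθ : 0 < θ) (hθ1 : θ ≤ 1) {A : Set 𝔼} (hAm : MeasurableSet A)
    (hA : ∫⁻ y in A, ENNReal.ofReal (‖y‖ ^ (-t)) ≤ 1) {f : 𝔼 → ℝ≥0∞} (hf : Measurable f)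
    (hf1 : ∫⁻ y, f y ^ (N : ℝ) ≤ 1) (x : 𝔼) :
    ∫⁻ y in A, f y * ENNReal.ofReal (‖x - y‖ ^ (1 - N : ℝ)) ≤
      ENNReal.ofReal (θ ^ (1 - a)) *
        (ENNReal.ofReal (weightScale t x) * ∫⁻ y, f y * localKernel t a x y) +
      ENNReal.ofReal ((sphereArea N * log (1 / θ) + 4 ^ N) ^ (((N : ℝ) - 1) / N)) := by
  have : NeZero N := ⟨by omega⟩
  have hN' : (2 : ℝ) ≤ N := by exact_mod_cast hN
  set r := weightScale t x with hr
  have hr0 : 0 < r := weightScale_pos t x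
  have hδ : 0 < θ * r := mul_pos hθ hr0
  have hδr : θ * r ≤ r := mul_le_of_le_one_left hr0.le hθ1
  have hkx : Measurable (localKernel t a x) :=
    Measurable.of_uncurry_left (f := localKernel t a) (measurable_localKernel (N := N) t a)
  have hnear : ∫⁻ y in ball x (θ * r), f y * ENNReal.ofReal (‖x - y‖ ^ (1 - N : ℝ)) ≤
      ENNReal.ofReal (θ ^ (1 - a)) * (ENNReal.ofReal r * ∫⁻ y, f y * localKernel t a x y) := by
    rw [← mul_assoc, ← ENNReal.ofReal_mul (by positivity),
      ← lintegral_const_mul (f := fun y ↦ f y * localKernel t a x y) _ (hf.mul hkx)]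
    refine (setLIntegral_mono' measurableSet_ball fun y hy ↦ ?_).trans
      (setLIntegral_le_lintegral (ball x (θ * r)) _)
    have hd : ‖x - y‖ < θ * r := by simpa [dist_eq_norm_sub'] using hy
    have hyr : y ∈ ball x r := ball_subset_ball hδr hy
    rw [mul_left_comm]
    unfold localKernel
    rw [← hr, indicator_of_mem hyr, ← ENNReal.ofReal_mul (by positivity),
      ← ENNReal.ofReal_mul (by positivity)]
    gcongr
    rcases (norm_nonneg (x - y)).eq_or_lt with h0 | h0
    · rw [← h0, zero_rpow (by linarith)]
      positivity
    · calc ‖x - y‖ ^ (1 - N : ℝ) = ‖x - y‖ ^ (1 - a) * ‖x - y‖ ^ (a - N) := by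
            rw [← rpow_add h0]; ring_nf
        _ ≤ (θ * r) ^ (1 - a) * ‖x - y‖ ^ (a - N) := by gcongr
        _ = θ ^ (1 - a) * r * (r ^ (-a) * ‖x - y‖ ^ (a - N)) := by
            rw [mul_rpow hθ.le hr0.le, show 1 - a = 1 + -a by ring, rpow_add hr0, rpow_one]
            ring
  have hfar : ∫⁻ y in A ∩ (ball x (θ * r))ᶜ, f y * ENNReal.ofReal (‖x - y‖ ^ (1 - N : ℝ)) ≤
      ENNReal.ofReal ((sphereArea N * log (1 / θ) + 4 ^ N) ^ (((N : ℝ) - 1) / N)) := by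
    have hpq := Real.HolderConjugate.conjExponent (p := (N : ℝ)) (by linarith)
    have hlog : 0 ≤ log (1 / θ) := log_nonneg ((one_le_div hθ).2 hθ1)
    have hN1 : (0 : ℝ) < N - 1 := by linarith
    calc _ ≤ (∫⁻ y in A ∩ (ball x (θ * r))ᶜ, f y ^ (N : ℝ)) ^ (1 / (N : ℝ)) *
          (∫⁻ y in A ∩ (ball x (θ * r))ᶜ, ENNReal.ofReal (‖x - y‖ ^ (1 - N : ℝ)) ^
            (N : ℝ).conjExponent) ^ (1 / (N : ℝ).conjExponent) :=
          ENNReal.lintegral_mul_le_Lp_mul_Lq _ hpq hf.aemeasurable (by fun_prop)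
      _ ≤ 1 * (∫⁻ y in A ∩ (ball x (θ * r))ᶜ, ENNReal.ofReal (‖x - y‖ ^ (-N : ℝ))) ^
            (((N : ℝ) - 1) / N) := by
          gcongr ?_ * ?_
          · exact ENNReal.rpow_le_one ((setLIntegral_le_lintegral _ _).trans hf1) (by positivity)
          · rw [Real.conjExponent, one_div_div]
            refine le_of_eq (congrArg (· ^ (((N : ℝ) - 1) / N)) (lintegral_congr fun y ↦ ?_))
            rw [ENNReal.ofReal_rpow_of_nonneg (by positivity) (by positivity),
              ← rpow_mul (norm_nonneg _)]
            congr 2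
            field_simp
            ring
      _ ≤ _ := by
          rw [one_mul, ← ENNReal.ofReal_rpow_of_nonneg _ (by positivity)]
          · gcongr
            have := lintegral_far_kernel_le ht0 htN hAm hA x hδ hδr
            rwa [← hr, div_mul_cancel_right₀ hr0.ne', ← one_div] at this
          · have := sphereArea_pos (N := N)
            positivity
  calc _ ≤ ∫⁻ y in ball x (θ * r) ∪ A ∩ (ball x (θ * r))ᶜ,
        f y * ENNReal.ofReal (‖x - y‖ ^ (1 - N : ℝ)) := by
        refine lintegral_mono_set fun y hy ↦ ?_
        by_cases h : y ∈ ball x (θ * r)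
        · exact Or.inl h
        · exact Or.inr ⟨hy, h⟩
    _ ≤ _ := lintegral_union_le _ _ _
    _ ≤ _ := add_le_add hnear hfar

/-- Choice of the order of the truncated kernel: a subcritical exponential of the potential bound
is dominated by a power smaller than `N - t`. -/
theorem exists_exp_le_rpow (hN : 2 ≤ N) {t β : ℝ} (htN : t < N) (hβ0 : 0 < β)
    (hβ : β < ((N : ℝ) - t) * sphereArea N ^ (1 / ((N : ℝ) - 1))) :
    ∃ a q C : ℝ, 0 < a ∧ a < 1 ∧ 0 < q ∧ q < N - t ∧ 0 < C ∧ ∀ s H : ℝ, 0 ≤ s → 1 ≤ H →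
      sphereArea N * s ≤
        1 + (sphereArea N * (log H / (1 - a)) + 4 ^ N) ^ (((N : ℝ) - 1) / N) →
      exp (β * s ^ ((N : ℝ) / ((N : ℝ) - 1))) ≤ C * H ^ q := by
  have : NeZero N := ⟨by omega⟩
  have hN' : (2 : ℝ) ≤ N := by exact_mod_cast hN
  have hN1 : (0 : ℝ) < N - 1 := by linarith
  have hω := sphereArea_pos (N := N)
  set ω := sphereArea N with hωdef
  set p : ℝ := (N : ℝ) / ((N : ℝ) - 1) with hp
  have hp1 : 1 < p := by rw [hp, one_lt_div hN1]; linarith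
  have hpi : ((N : ℝ) - 1) / N * p = 1 := by rw [hp]; field_simp
  have hωpos : 0 < ω ^ (1 / ((N : ℝ) - 1)) := by positivity
  set κ := β / ω ^ (1 / ((N : ℝ) - 1)) with hκ
  have hκ0 : 0 < κ := by positivity
  have hκt : κ < N - t := by rwa [hκ, div_lt_iff₀ hωpos]
  set q := (κ + (N - t)) / 2 with hq
  have hκq : κ < q := by rw [hq]; linarith
  set ρ := √(q / κ) with hρ
  have hρ1 : 1 < ρ := by
    rw [hρ, Real.lt_sqrt (by norm_num), one_pow, one_lt_div hκ0]; exact hκq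
  have hρ2 : ρ * ρ = q / κ := Real.mul_self_sqrt (by have := hκ0.trans hκq; positivity)
  have hρ0 : 0 < ρ := by linarith
  obtain ⟨D, hD0, hD⟩ := exists_one_add_rpow_le hp1 (ε := ρ - 1) (by linarith)
  have hβκ : β * (ω ^ p)⁻¹ * ω = κ := by
    have : p = 1 / ((N : ℝ) - 1) + 1 := by rw [hp]; field_simp; ring
    rw [this, rpow_add hω, rpow_one, hκ]
    field_simp
  refine ⟨1 - ρ⁻¹, q, exp (β * (ω ^ p)⁻¹ * (ρ * 4 ^ N + D)), by
    linarith [inv_lt_one_of_one_lt₀ hρ1], by linarith [inv_pos.2 hρ0], by linarith,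
    by rw [hq]; linarith, exp_pos _, fun s H hs hH hsH ↦ ?_⟩
  have hlog : 0 ≤ log H := log_nonneg hH
  rw [sub_sub_cancel, div_inv_eq_mul] at hsH
  set L := ω * (log H * ρ) + 4 ^ N with hL
  have hL0 : 0 ≤ L := by positivity
  have h1 : (ω * s) ^ p ≤ ρ * L + D := by
    calc (ω * s) ^ p ≤ (1 + L ^ (((N : ℝ) - 1) / N)) ^ p := by gcongr
      _ ≤ (1 + (ρ - 1)) * (L ^ (((N : ℝ) - 1) / N)) ^ p + D := hD _ (by positivity)
      _ = ρ * L + D := by rw [← rpow_mul hL0, hpi, rpow_one]; ring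
  rw [mul_rpow hω.le hs] at h1
  rw [rpow_def_of_pos (show 0 < H by linarith), ← exp_add]
  refine exp_le_exp.2 ?_
  calc β * s ^ p = β * (ω ^ p)⁻¹ * (ω ^ p * s ^ p) := by field_simp
    _ ≤ β * (ω ^ p)⁻¹ * (ρ * L + D) := by gcongr
    _ = β * (ω ^ p)⁻¹ * (ρ * 4 ^ N + D) + (β * (ω ^ p)⁻¹ * ω) * (ρ * ρ) * log H := by
        rw [hL]; ring
    _ = _ := by rw [hβκ, hρ2]; field_simp

/-- Pointwise exponential bound on the superlevel set in terms of the truncated potential. -/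
theorem ofReal_exp_le_potential (hN : 2 ≤ N) {t β a q C : ℝ} (ht0 : 0 ≤ t) (htN : t < N)
    (ha1 : a < 1) (hq : 0 < q) (hC : 0 < C)
    (hexp : ∀ s H : ℝ, 0 ≤ s → 1 ≤ H →
      sphereArea N * s ≤
        1 + (sphereArea N * (log H / (1 - a)) + 4 ^ N) ^ (((N : ℝ) - 1) / N) →
      exp (β * s ^ ((N : ℝ) / ((N : ℝ) - 1))) ≤ C * H ^ q)
    {w : 𝔼 → ℝ} (hw : ContDiff ℝ 1 w) (hw1 : ∫⁻ y, ‖fderiv ℝ w y‖ₑ ^ (N : ℝ) ≤ 1)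
    (hA : ∫⁻ y in {y | 1 < |w y|}, ENNReal.ofReal (‖y‖ ^ (-t)) ≤ 1) {x : 𝔼} (hx : 1 < |w x|) :
    ENNReal.ofReal (exp (β * (|w x| - 1) ^ ((N : ℝ) / ((N : ℝ) - 1)))) ≤
      ENNReal.ofReal C * (1 + (ENNReal.ofReal (weightScale t x) *
        ∫⁻ y, ‖fderiv ℝ w y‖ₑ * localKernel t a x y) ^ q) := by
  have : NeZero N := ⟨by omega⟩
  set M := ENNReal.ofReal (weightScale t x) * ∫⁻ y, ‖fderiv ℝ w y‖ₑ * localKernel t a x y with hM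
  have hdw : Measurable fun y ↦ ‖fderiv ℝ w y‖ₑ :=
    (hw.continuous_fderiv one_ne_zero).enorm.measurable
  have hAm : MeasurableSet {y | 1 < |w y|} :=
    (isOpen_lt continuous_const hw.continuous.abs).measurableSet
  rcases eq_or_ne M ∞ with hMt | hMt
  · simp [hMt, ENNReal.top_rpow_of_pos hq, ENNReal.mul_top, hC]
  set H := max 1 M.toReal with hH
  have hH1 : 1 ≤ H := le_max_left _ _
  have hH0 : 0 < H := by linarith
  have h1a : 0 < 1 - a := by linarith
  set θ := H ^ (-(1 / (1 - a))) with hθ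
  have hθ0 : 0 < θ := by positivity
  have hθ1 : θ ≤ 1 := rpow_le_one_of_one_le_of_nonpos hH1 (by rw [neg_nonpos]; positivity)
  have hθa : θ ^ (1 - a) = H⁻¹ := by
    rw [hθ, ← rpow_mul hH0.le, neg_mul, one_div_mul_cancel h1a.ne', rpow_neg_one]
  have hlogθ : log (1 / θ) = log H / (1 - a) := by
    rw [one_div, log_inv, hθ, log_rpow hH0]; ring
  have hpot := (ofReal_sphereArea_mul_le_potential ht0 htN hw (hA.trans_lt ENNReal.one_lt_top).ne
    x).trans (potential_le_localKernel_add_log hN ht0 htN ha1 hθ0 hθ1 hAm hA hdw hw1 x)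
  rw [← hM, hθa, hlogθ] at hpot
  have hMH : ENNReal.ofReal H⁻¹ * M ≤ 1 := by
    rw [← ENNReal.ofReal_toReal hMt, ← ENNReal.ofReal_mul (by positivity), ← ENNReal.ofReal_one]
    refine ENNReal.ofReal_le_ofReal ?_
    rw [inv_mul_le_iff₀ hH0, mul_one]
    exact le_max_right _ _
  have hs : sphereArea N * (|w x| - 1) ≤
      1 + (sphereArea N * (log H / (1 - a)) + 4 ^ N) ^ (((N : ℝ) - 1) / N) := by
    have hlog : 0 ≤ log H := log_nonneg hH1
    have hω := sphereArea_pos (N := N)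
    have h2 := hpot.trans (add_le_add_left hMH _)
    rw [← ENNReal.ofReal_mul hω.le, ← ENNReal.ofReal_one, ← ENNReal.ofReal_add zero_le_one
      (by positivity)] at h2
    exact (ENNReal.ofReal_le_ofReal_iff (by positivity)).1 h2
  calc _ ≤ ENNReal.ofReal (C * H ^ q) :=
        ENNReal.ofReal_le_ofReal (hexp _ _ (by linarith) hH1 hs)
    _ = ENNReal.ofReal C * (ENNReal.ofReal H) ^ q := by
        rw [ENNReal.ofReal_mul hC.le, ENNReal.ofReal_rpow_of_pos hH0]
    _ ≤ _ := by
        gcongr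
        rcases max_cases 1 M.toReal with hm | hm
        · rw [hH, hm.1]; simp
        · rw [hH, hm.1, ENNReal.ofReal_toReal hMt]; exact le_add_self

end Superlevel

section Normalized

open Set Metric Measure
open scoped ENNReal

theorem ofReal_weightScale_rpow_mul_le [NeZero N] {t q : ℝ} (ht0 : 0 ≤ t) (hq : 0 < q)
    (hqN : q < N) (x : 𝔼) :
    (ENNReal.ofReal (weightScale t x) ^ q * ENNReal.ofReal (‖x‖ ^ (-t))) ^ ((N : ℝ) / (N - q)) ≤
      ENNReal.ofReal (2 ^ (t * q / (N - q))) * (ENNReal.ofReal (‖x‖ ^ (-t)) +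
        (ball 0 1).indicator (fun x ↦ ENNReal.ofReal (‖x‖ ^ ((N - t * N / (N - q)) - N))) x) := by
  have hN : (0 : ℝ) < N := by exact_mod_cast Nat.pos_of_ne_zero (NeZero.ne N)
  have hNq : 0 < N - q := by linarith
  have hr := weightScale_pos t x
  have hx := norm_nonneg x
  rw [ENNReal.ofReal_rpow_of_pos hr, ← ENNReal.ofReal_mul (by positivity),
    ENNReal.ofReal_rpow_of_nonneg (by positivity) (by positivity)]
  have h1 : (weightScale t x ^ q * ‖x‖ ^ (-t)) ^ ((N : ℝ) / (N - q)) ≤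
      (1 + ‖x‖) ^ (t * q / (N - q)) * ‖x‖ ^ ((N - t * N / (N - q)) - N) := by
    rw [mul_rpow (by positivity) (by positivity), ← rpow_mul hr.le, ← rpow_mul hx]
    have h2 : weightScale t x ≤ (1 + ‖x‖) ^ (t / N) := by
      unfold weightScale
      have : (0 : ℝ) ≤ (1 + ‖x‖) ^ (t / N) := by positivity
      linarith
    calc _ ≤ ((1 + ‖x‖) ^ (t / N)) ^ (q * (N / (N - q))) * ‖x‖ ^ (-t * (N / (N - q))) := by gcongr
      _ = _ := by
        rw [← rpow_mul (by positivity)]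
        congr 2 <;> field_simp
        ring
  rcases lt_or_ge ‖x‖ 1 with h | h
  · rw [indicator_of_mem (by simpa using h)]
    refine le_trans ?_ (mul_le_mul_right le_add_self _)
    rw [← ENNReal.ofReal_mul (by positivity)]
    refine ENNReal.ofReal_le_ofReal (h1.trans ?_)
    gcongr
    linarith
  · refine le_trans ?_ (mul_le_mul_right le_self_add _)
    rw [← ENNReal.ofReal_mul (by positivity)]
    refine ENNReal.ofReal_le_ofReal (h1.trans ?_)
    calc _ ≤ (2 * ‖x‖) ^ (t * q / (N - q)) * ‖x‖ ^ ((N - t * N / (N - q)) - N) := by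
          gcongr; linarith
      _ = _ := by
        rw [mul_rpow (by norm_num) hx, mul_assoc, ← rpow_add (by linarith)]
        congr 2
        field_simp
        ring

/-- The Moser–Trudinger bound on the superlevel set `{1 < |w|}` for `C¹` functions, when this set
has weighted measure at most one. -/
theorem exists_lintegral_superlevel_le (hN : 2 ≤ N) {t β : ℝ} (ht0 : 0 ≤ t) (htN : t < N)
    (hβ0 : 0 < β) (hβ : β < ((N : ℝ) - t) * sphereArea N ^ (1 / ((N : ℝ) - 1))) :
    ∃ C : ℝ≥0∞, C ≠ ∞ ∧ ∀ w : 𝔼 → ℝ, ContDiff ℝ 1 w →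
      ∫⁻ y, ‖fderiv ℝ w y‖ₑ ^ (N : ℝ) ≤ 1 →
      ∫⁻ y in {y | 1 < |w y|}, ENNReal.ofReal (‖y‖ ^ (-t)) ≤ 1 →
      ∫⁻ x in {y | 1 < |w y|}, ENNReal.ofReal (exp (β * (|w x| - 1) ^ ((N : ℝ) / ((N : ℝ) - 1)))) *
        ENNReal.ofReal (‖x‖ ^ (-t)) ≤ C := by
  have : NeZero N := ⟨by omega⟩
  have hN' : (2 : ℝ) ≤ N := by exact_mod_cast hN
  obtain ⟨a, q, C, ha0, ha1, hq0, hqN, hC, hexp⟩ := exists_exp_le_rpow hN htN hβ0 hβ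
  have hqN' : q < N := by linarith
  have hNq : 0 < N - q := by linarith
  have hb : 0 < N - t * N / (N - q) := by
    rw [sub_pos, div_lt_iff₀ hNq]; nlinarith
  set D := ENNReal.ofReal (sphereArea N / a) ^ ((N : ℝ) - 1) *
    ENNReal.ofReal (4 ^ a * (sphereArea N / a)) with hD
  set B := ENNReal.ofReal (2 ^ (t * q / (N - q))) * (1 + ENNReal.ofReal (sphereArea N *
    (1 ^ (N - t * N / (N - q)) / (N - t * N / (N - q))))) with hB
  have hDt : D ≠ ∞ := ENNReal.mul_ne_top
    (ENNReal.rpow_ne_top_of_nonneg (by linarith) ENNReal.ofReal_ne_top) ENNReal.ofReal_ne_top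
  have hBt : B ≠ ∞ := ENNReal.mul_ne_top ENNReal.ofReal_ne_top
    (ENNReal.add_ne_top.2 ⟨ENNReal.one_ne_top, ENNReal.ofReal_ne_top⟩)
  refine ⟨ENNReal.ofReal C * (1 + D ^ (1 / (N / q)) * B ^ (1 / (N / (N - q)))), ?_,
    fun w hw hw1 hA ↦ ?_⟩
  · refine ENNReal.mul_ne_top ENNReal.ofReal_ne_top (ENNReal.add_ne_top.2 ⟨ENNReal.one_ne_top,
      ENNReal.mul_ne_top ?_ ?_⟩) <;> refine ENNReal.rpow_ne_top_of_nonneg (by positivity) ‹_›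
  have hdw : Measurable fun y ↦ ‖fderiv ℝ w y‖ₑ :=
    (hw.continuous_fderiv one_ne_zero).enorm.measurable
  have hAm : MeasurableSet {y | 1 < |w y|} :=
    (isOpen_lt continuous_const hw.continuous.abs).measurableSet
  set A := {y | 1 < |w y|} with hAdef
  set G : 𝔼 → ℝ≥0∞ := fun x ↦ ∫⁻ y, ‖fderiv ℝ w y‖ₑ * localKernel t a x y with hG
  have hGm : Measurable G := Measurable.lintegral_prod_right'
    (f := fun p : 𝔼 × 𝔼 ↦ ‖fderiv ℝ w p.2‖ₑ * localKernel t a p.1 p.2)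
    ((hdw.comp measurable_snd).mul (measurable_localKernel t a))
  have hGN : ∫⁻ x, G x ^ (N : ℝ) ≤ D :=
    lintegral_localKernel_rpow_le ht0 htN ha0 (by linarith) hdw hw1
  have hrm : Measurable fun x : 𝔼 ↦ ENNReal.ofReal (weightScale t x) :=
    (continuous_weightScale t).measurable.ennreal_ofReal
  have hwm : Measurable fun x : 𝔼 ↦ ENNReal.ofReal (‖x‖ ^ (-t)) := by fun_prop
  have hpq : ((N : ℝ) / q).HolderConjugate (N / (N - q)) := by
    rw [Real.holderConjugate_iff, one_lt_div hq0]
    refine ⟨hqN', ?_⟩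
    rw [inv_div, inv_div, ← add_div, add_sub_cancel, div_self (by linarith)]
  have hweight : ∫⁻ x in A, (ENNReal.ofReal (weightScale t x) ^ q *
      ENNReal.ofReal (‖x‖ ^ (-t))) ^ ((N : ℝ) / (N - q)) ≤ B := by
    calc _ ≤ ∫⁻ x in A, ENNReal.ofReal (2 ^ (t * q / (N - q))) * (ENNReal.ofReal (‖x‖ ^ (-t)) +
          (ball 0 1).indicator (fun x ↦ ENNReal.ofReal (‖x‖ ^ ((N - t * N / (N - q)) - N))) x) :=
          lintegral_mono fun x ↦ ofReal_weightScale_rpow_mul_le ht0 hq0 hqN' x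
      _ ≤ B := by
        rw [lintegral_const_mul' _ _ ENNReal.ofReal_ne_top, lintegral_add_left hwm, hB]
        gcongr
        rw [← lintegral_ball_norm_rpow_sub (N := N) hb zero_le_one,
          ← lintegral_indicator measurableSet_ball]
        exact setLIntegral_le_lintegral _ _
  calc _ ≤ ∫⁻ x in A, ENNReal.ofReal C * (ENNReal.ofReal (‖x‖ ^ (-t)) +
        G x ^ q * (ENNReal.ofReal (weightScale t x) ^ q * ENNReal.ofReal (‖x‖ ^ (-t)))) := by
        refine setLIntegral_mono' hAm fun x hx ↦ ?_
        refine (mul_le_mul_left (ofReal_exp_le_potential hN ht0 htN ha1 hq0 hC hexp hw hw1 hA hx)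
          _).trans (le_of_eq ?_)
        rw [ENNReal.mul_rpow_of_nonneg _ _ hq0.le]
        ring
    _ = ENNReal.ofReal C * ((∫⁻ x in A, ENNReal.ofReal (‖x‖ ^ (-t))) + ∫⁻ x in A,
        G x ^ q * (ENNReal.ofReal (weightScale t x) ^ q * ENNReal.ofReal (‖x‖ ^ (-t)))) := by
        rw [lintegral_const_mul' _ _ ENNReal.ofReal_ne_top, lintegral_add_left hwm]
    _ ≤ _ := by
        gcongr
        refine (ENNReal.lintegral_mul_le_Lp_mul_Lq _ hpq (hGm.pow_const q).aemeasurable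
          ((hrm.pow_const q).mul hwm).aemeasurable).trans ?_
        gcongr
        · refine (setLIntegral_le_lintegral _ _).trans ((le_of_eq ?_).trans hGN)
          refine lintegral_congr fun x ↦ ?_
          rw [← ENNReal.rpow_mul, mul_div_cancel₀ _ hq0.ne']
        · exact hweight

end Normalized

section Scaling

open Set Metric Measure
open scoped ENNReal

theorem lintegral_comp_pos_smul {r : ℝ} (hr : 0 < r) (f : 𝔼 → ℝ≥0∞) :
    ∫⁻ x, f (r • x) = ENNReal.ofReal (r ^ (-N : ℝ)) * ∫⁻ x, f x := by
  have h : MeasurableEmbedding fun x : 𝔼 ↦ r • x :=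
    (Homeomorph.smulOfNeZero r hr.ne').measurableEmbedding
  rw [← h.lintegral_map, map_addHaar_smul volume hr.ne', lintegral_smul_measure,
    finrank_euclideanSpace_fin, abs_of_pos (by positivity), rpow_neg hr.le, rpow_natCast,
    smul_eq_mul]

theorem setLIntegral_comp_pos_smul_norm_rpow {r : ℝ} (hr : 0 < r) (t : ℝ) {A : Set 𝔼}
    (hA : MeasurableSet A) (h : 𝔼 → ℝ≥0∞) :
    ∫⁻ x in (r • ·) ⁻¹' A, h (r • x) * ENNReal.ofReal (‖x‖ ^ (-t)) =
      ENNReal.ofReal (r ^ (t - N)) * ∫⁻ x in A, h x * ENNReal.ofReal (‖x‖ ^ (-t)) := by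
  have hA' : MeasurableSet ((fun x : 𝔼 ↦ r • x) ⁻¹' A) := measurable_const_smul r hA
  rw [← lintegral_indicator hA', ← lintegral_indicator hA, sub_eq_add_neg, rpow_add hr,
    ENNReal.ofReal_mul (by positivity), mul_assoc, ← lintegral_comp_pos_smul hr,
    ← lintegral_const_mul' _ _ ENNReal.ofReal_ne_top]
  refine lintegral_congr fun x ↦ ?_
  by_cases hx : r • x ∈ A
  · rw [indicator_of_mem (by exact hx), indicator_of_mem hx, mul_left_comm,
      ← ENNReal.ofReal_mul (by positivity), norm_smul, norm_of_nonneg hr.le,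
      mul_rpow hr.le (norm_nonneg x), ← mul_assoc, ← rpow_add hr, add_neg_cancel, rpow_zero,
      one_mul]
  · rw [indicator_of_notMem (by exact hx), indicator_of_notMem hx, mul_zero]

/-- The scale-invariant form of `exists_lintegral_superlevel_le`. -/
theorem exists_lintegral_superlevel_le_mul (hN : 2 ≤ N) {t β : ℝ} (ht0 : 0 ≤ t) (htN : t < N)
    (hβ0 : 0 < β) (hβ : β < ((N : ℝ) - t) * sphereArea N ^ (1 / ((N : ℝ) - 1))) :
    ∃ C : ℝ≥0∞, C ≠ ∞ ∧ ∀ (w : 𝔼 → ℝ) (M : ℝ), ContDiff ℝ 1 w → 0 < M →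
      ∫⁻ y, ‖fderiv ℝ w y‖ₑ ^ (N : ℝ) ≤ 1 →
      ∫⁻ y in {y | 1 < |w y|}, ENNReal.ofReal (‖y‖ ^ (-t)) ≤ ENNReal.ofReal M →
      ∫⁻ x in {y | 1 < |w y|}, ENNReal.ofReal (exp (β * (|w x| - 1) ^ ((N : ℝ) / ((N : ℝ) - 1)))) *
        ENNReal.ofReal (‖x‖ ^ (-t)) ≤ C * ENNReal.ofReal M := by
  obtain ⟨C, hC, h⟩ := exists_lintegral_superlevel_le hN ht0 htN hβ0 hβ
  refine ⟨C, hC, fun w M hw hM hw1 hA ↦ ?_⟩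
  have hNt : 0 < N - t := by linarith
  set r := M ^ (1 / (N - t)) with hr
  have hr0 : 0 < r := by positivity
  have hrM : r ^ (t - N) = M⁻¹ := by
    rw [hr, ← rpow_mul hM.le, ← rpow_neg_one]
    congr 1
    field_simp
    ring
  have hAm : MeasurableSet {y | 1 < |w y|} :=
    (isOpen_lt continuous_const hw.continuous.abs).measurableSet
  have hMinv : ENNReal.ofReal M⁻¹ * ENNReal.ofReal M = 1 := by
    rw [← ENNReal.ofReal_mul (by positivity), inv_mul_cancel₀ hM.ne', ENNReal.ofReal_one]
  have hv := h (fun x ↦ w (r • x)) (hw.comp (contDiff_const_smul r)) ?_ ?_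
  · have h2 := setLIntegral_comp_pos_smul_norm_rpow hr0 t hAm fun x ↦
      ENNReal.ofReal (exp (β * (|w x| - 1) ^ ((N : ℝ) / ((N : ℝ) - 1))))
    rw [hrM] at h2
    replace hv := h2.symm.trans_le hv
    refine le_of_eq_of_le ?_ ((mul_le_mul_right hv (ENNReal.ofReal M)).trans_eq (mul_comm _ _))
    rw [← mul_assoc, mul_comm (ENNReal.ofReal M), hMinv, one_mul]
  · have hd : ∀ y, fderiv ℝ (fun x ↦ w (r • x)) y = r • fderiv ℝ w (r • y) := fun y ↦
      fderiv_comp_smul r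
    calc ∫⁻ y, ‖fderiv ℝ (fun x ↦ w (r • x)) y‖ₑ ^ (N : ℝ)
        = ∫⁻ y, ENNReal.ofReal (r ^ (N : ℝ)) * ‖fderiv ℝ w (r • y)‖ₑ ^ (N : ℝ) := by
          refine lintegral_congr fun y ↦ ?_
          rw [hd, enorm_smul, ENNReal.mul_rpow_of_nonneg _ _ (Nat.cast_nonneg N),
            Real.enorm_of_nonneg hr0.le, ENNReal.ofReal_rpow_of_pos hr0]
      _ = ∫⁻ y, ‖fderiv ℝ w y‖ₑ ^ (N : ℝ) := by
          rw [lintegral_const_mul' _ _ ENNReal.ofReal_ne_top,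
            lintegral_comp_pos_smul hr0 (fun y ↦ ‖fderiv ℝ w y‖ₑ ^ (N : ℝ)), ← mul_assoc,
            ← ENNReal.ofReal_mul (by positivity), ← rpow_add hr0, add_neg_cancel, rpow_zero,
            ENNReal.ofReal_one, one_mul]
      _ ≤ 1 := hw1
  · have h2 := setLIntegral_comp_pos_smul_norm_rpow hr0 t hAm fun _ ↦ 1
    simp only [one_mul, hrM] at h2
    refine h2.trans_le ?_
    rw [← hMinv]
    gcongr

end Scaling

section Mollification

open Set Metric Measure
open scoped ENNReal Convolution

open ContinuousLinearMap in
theorem fderiv_convolution_apply {G : Type*} [NormedAddCommGroup G] [NormedSpace ℝ G]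
    [MeasurableSpace G] [BorelSpace G] [FiniteDimensional ℝ G] {μ : Measure G}
    [μ.IsAddHaarMeasure] {ρ u : G → ℝ} (hρ : ContDiff ℝ 1 ρ) (hcρ : HasCompactSupport ρ)
    (hu : LocallyIntegrable u μ) (x v : G) :
    fderiv ℝ (ρ ⋆[lsmul ℝ ℝ, μ] u) x v = ∫ y, u y * fderiv ℝ ρ (x - y) v ∂μ := by
  have hex := (hcρ.fderiv ℝ).convolutionExists_left
    ((lsmul ℝ ℝ : ℝ →L[ℝ] ℝ →L[ℝ] ℝ).precompL G) (hρ.continuous_fderiv one_ne_zero) hu x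
  have h_integrable := hex.integrable_swap
  rw [(hcρ.hasFDerivAt_convolution_left (lsmul ℝ ℝ) hρ hu x).fderiv, convolution_eq_swap,
    ContinuousLinearMap.integral_apply h_integrable]
  simp only [precompL_apply, lsmul_apply, smul_eq_mul, mul_comm]

/-- The derivative of a mollification is the mollification of the weak gradient. -/
theorem HasWeakGradient.fderiv_convolution {u : 𝔼 → ℝ} {g : 𝔼 → 𝔼} (h : HasWeakGradient u g)
    {ρ : 𝔼 → ℝ} (hρ : ContDiff ℝ (⊤ : ℕ∞) ρ) (hcρ : HasCompactSupport ρ) (x : 𝔼) :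
    fderiv ℝ (ρ ⋆[ContinuousLinearMap.lsmul ℝ ℝ, volume] u) x =
      innerSL ℝ (∫ y, ρ (x - y) • g y) := by
  have hρ1 : ContDiff ℝ 1 ρ := hρ.of_le (by exact_mod_cast le_top)
  have hex := hcρ.convolutionExists_left (ContinuousLinearMap.lsmul ℝ ℝ : ℝ →L[ℝ] 𝔼 →L[ℝ] 𝔼)
    hρ.continuous h.2.1 x
  have h_integrable : Integrable fun y ↦ ρ (x - y) • g y := hex.integrable_swap
  refine ContinuousLinearMap.coe_injective
    ((EuclideanSpace.basisFun (Fin N) ℝ).toBasis.ext fun i ↦ ?_)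
  have htest := h.2.2 (fun y ↦ ρ (x - y)) (hρ.comp (contDiff_const.sub contDiff_id))
    (hcρ.comp_homeomorph (Homeomorph.subLeft x)) i
  have hd : ∀ y, fderiv ℝ (fun y ↦ ρ (x - y)) y = -fderiv ℝ ρ (x - y) := fun y ↦
    ((hρ1.differentiable one_ne_zero (x - y)).hasFDerivAt.comp y
      ((hasFDerivAt_id y).const_sub x)).fderiv.trans (by ext; simp)
  simp only [hd, _root_.neg_apply, mul_neg, integral_neg, neg_inj] at htest
  have hcoord : (∫ y, ρ (x - y) • g y) i = ∫ y, g y i * ρ (x - y) := by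
    refine ((EuclideanSpace.proj (𝕜 := ℝ) i).integral_comp_comm h_integrable).symm.trans ?_
    exact integral_congr_ae (.of_forall fun y ↦ by simp [mul_comm])
  simp only [OrthonormalBasis.coe_toBasis, EuclideanSpace.basisFun_apply,
    ContinuousLinearMap.coe_coe, innerSL_apply_apply]
  rw [fderiv_convolution_apply hρ1 hcρ h.1, EuclideanSpace.inner_single_right, htest, hcoord]
  simp

/-- A weighted form of Young's inequality for convolution with a probability density. -/
theorem lintegral_convolution_rpow_mul_le {p : ℝ} (hp : 1 < p) {f k m : 𝔼 → ℝ≥0∞}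
    (hf : AEMeasurable f) (hk : Measurable k) (hk1 : ∫⁻ x, k x = 1) (hm : Measurable m) :
    ∫⁻ x, (∫⁻ y, f y * k (x - y)) ^ p * m x ≤ ∫⁻ y, f y ^ p * ∫⁻ x, k (x - y) * m x := by
  have hk2 : Measurable fun z : 𝔼 × 𝔼 ↦ k (z.1 - z.2) := hk.comp (by fun_prop)
  calc _ ≤ ∫⁻ x, ∫⁻ y, f y ^ p * k (x - y) * m x := by
        refine lintegral_mono fun x ↦ ?_
        have hkx : Measurable fun y ↦ k (x - y) := hk.comp (by fun_prop)
        have h := lintegral_mul_rpow_le hp hf hkx.aemeasurable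
        rw [lintegral_sub_left_eq_self k x, hk1, ENNReal.one_rpow, one_mul] at h
        rw [lintegral_mul_const'' (f := fun y ↦ f y ^ p * k (x - y)) _
          ((hf.pow_const p).mul hkx.aemeasurable)]
        gcongr
    _ = ∫⁻ y, ∫⁻ x, f y ^ p * k (x - y) * m x :=
        lintegral_lintegral_swap ((((hf.pow_const p).comp_snd (μ := volume)).mul
          hk2.aemeasurable).mul (hm.comp measurable_fst).aemeasurable)
    _ = _ := by
        refine lintegral_congr fun y ↦ ?_
        have hky : Measurable fun x ↦ k (x - y) := hk.comp (by fun_prop)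
        simp_rw [mul_assoc]
        exact lintegral_const_mul (f := fun x ↦ k (x - y) * m x) _ (hky.mul hm)

theorem ContDiffBump.lintegral_ofReal_normed (φ : ContDiffBump (0 : 𝔼)) :
    ∫⁻ x, ENNReal.ofReal (φ.normed volume x) = 1 := by
  rw [← ofReal_integral_eq_lintegral_ofReal φ.integrable_normed
    (.of_forall φ.nonneg_normed), φ.integral_normed, ENNReal.ofReal_one]

/-- The weight `‖x‖ ^ (-t)` is almost invariant under mollification, uniformly in the scale. -/
theorem exists_lintegral_normed_mul_norm_rpow_le [NeZero N] {t : ℝ} (ht0 : 0 ≤ t) (htN : t < N) :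
    ∃ C : ℝ≥0∞, C ≠ ∞ ∧ ∀ φ : ContDiffBump (0 : 𝔼), φ.rOut ≤ 2 * φ.rIn → ∀ y : 𝔼, y ≠ 0 →
      ∫⁻ x, ENNReal.ofReal (φ.normed volume (x - y)) * ENNReal.ofReal (‖x‖ ^ (-t)) ≤
        C * ENNReal.ofReal (‖y‖ ^ (-t)) := by
  have hN : (0 : ℝ) < N := by exact_mod_cast Nat.pos_of_ne_zero (NeZero.ne N)
  have hNt : 0 < N - t := by linarith
  have hω := sphereArea_pos (N := N)
  set K : ℝ := 2 ^ N * N * 3 ^ (N - t) / (N - t) with hK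
  have hK0 : 0 ≤ K := by positivity
  refine ⟨ENNReal.ofReal (2 ^ t * (1 + K)), ENNReal.ofReal_ne_top, fun φ hφ y hy ↦ ?_⟩
  have hy0 : 0 < ‖y‖ := norm_pos_iff.2 hy
  set ε := φ.rOut with hε
  have hε0 : 0 < ε := φ.rOut_pos
  have hsupp : ∀ x, ¬ ‖x - y‖ < ε → φ.normed volume (x - y) = 0 := fun x hx ↦ by
    rw [← Function.notMem_support, φ.support_normed_eq, mem_ball_zero_iff]
    exact hx
  have hmeas : Measurable fun x ↦ ENNReal.ofReal (φ.normed volume (x - y)) :=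
    (φ.continuous_normed.comp (by fun_prop)).measurable.ennreal_ofReal
  rw [← ENNReal.ofReal_mul (by positivity)]
  rcases le_or_gt (2 * ε) ‖y‖ with hye | hye
  · calc _ ≤ ∫⁻ x, ENNReal.ofReal (φ.normed volume (x - y)) *
          ENNReal.ofReal (2 ^ t * ‖y‖ ^ (-t)) := by
          refine lintegral_mono fun x ↦ ?_
          by_cases hx : ‖x - y‖ < ε
          · have h1 : ‖y‖ / 2 ≤ ‖x‖ := by
              have := norm_sub_norm_le y x
              rw [norm_sub_rev] at this
              linarith
            refine mul_le_mul_right (ENNReal.ofReal_le_ofReal ?_) _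
            calc ‖x‖ ^ (-t) ≤ (‖y‖ / 2) ^ (-t) :=
                  rpow_le_rpow_of_nonpos (by positivity) h1 (by linarith)
              _ = _ := by
                  rw [div_rpow hy0.le (by norm_num), rpow_neg (by norm_num : (0 : ℝ) ≤ 2), div_inv_eq_mul,
                    mul_comm]
          · simp [hsupp x hx]
      _ = ENNReal.ofReal (2 ^ t * ‖y‖ ^ (-t)) := by
          rw [lintegral_mul_const _ hmeas,
            lintegral_sub_right_eq_self (fun x ↦ ENNReal.ofReal (φ.normed volume x)) y,
            ContDiffBump.lintegral_ofReal_normed, one_mul]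
      _ ≤ _ := by
          refine ENNReal.ofReal_le_ofReal ?_
          have : (0 : ℝ) ≤ 2 ^ t * ‖y‖ ^ (-t) := by positivity
          nlinarith
  · have hvol : volume.real (closedBall (0 : 𝔼) ε) = ε ^ N * (sphereArea N / N) := by
      rw [addHaar_real_closedBall _ _ hε0.le, finrank_euclideanSpace_fin, sphereArea, measureReal_def]
      field_simp
    have hbound : ∀ x, φ.normed volume x ≤ 2 ^ N * N / (ε ^ N * sphereArea N) := fun x ↦ by
      refine (φ.normed_le_div_measure_closedBall_rOut volume 2 hφ x).trans_eq ?_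
      rw [finrank_euclideanSpace_fin, ← hε, hvol]
      field_simp
    calc _ ≤ ∫⁻ x, (ball (0 : 𝔼) (3 * ε)).indicator (fun x ↦
          ENNReal.ofReal (2 ^ N * N / (ε ^ N * sphereArea N)) *
            ENNReal.ofReal (‖x‖ ^ ((N - t) - N))) x := by
          refine lintegral_mono fun x ↦ ?_
          by_cases hx : ‖x - y‖ < ε
          · have h1 : ‖x‖ < 3 * ε := by
              have := norm_sub_norm_le x y
              linarith
            rw [indicator_of_mem (by simpa using h1), sub_right_comm, sub_self, zero_sub]
            gcongr
            exact hbound _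
          · simp [hsupp x hx]
      _ = ENNReal.ofReal (2 ^ N * N / (ε ^ N * sphereArea N)) *
          ENNReal.ofReal (sphereArea N * ((3 * ε) ^ (N - t) / (N - t))) := by
          rw [lintegral_indicator measurableSet_ball, lintegral_const_mul' _ _ ENNReal.ofReal_ne_top,
            lintegral_ball_norm_rpow_sub hNt (by positivity)]
      _ = ENNReal.ofReal (K * ε ^ (-t)) := by
          rw [← ENNReal.ofReal_mul (by positivity)]
          congr 1
          rw [mul_rpow (by norm_num) hε0.le, sub_eq_add_neg (N : ℝ) t, rpow_add hε0, rpow_natCast, hK,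
            sub_eq_add_neg]
          field_simp
      _ ≤ _ := by
          refine ENNReal.ofReal_le_ofReal ?_
          have h1 : ε ^ (-t) ≤ 2 ^ t * ‖y‖ ^ (-t) := by
            calc ε ^ (-t) ≤ (‖y‖ / 2) ^ (-t) :=
                  rpow_le_rpow_of_nonpos (by positivity) (by linarith) (by linarith)
              _ = _ := by
                  rw [div_rpow hy0.le (by norm_num), rpow_neg (by norm_num : (0 : ℝ) ≤ 2), div_inv_eq_mul,
                    mul_comm]
          have h2 : (0 : ℝ) ≤ 2 ^ t * ‖y‖ ^ (-t) := by positivity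
          nlinarith [mul_le_mul_of_nonneg_left h1 hK0]

end Mollification

section Approximation

open Set Metric Measure Filter Topology
open scoped ENNReal Convolution

/-- The exponential integrand, cut off to the superlevel set `{1 < |s|}`. -/
noncomputable def superlevelExp (β p s : ℝ) : ℝ≥0∞ :=
  {s : ℝ | 1 < |s|}.indicator (fun s ↦ ENNReal.ofReal (exp (β * (|s| - 1) ^ p))) s

theorem measurableSet_one_lt_abs : MeasurableSet {s : ℝ | 1 < |s|} :=
  (isOpen_lt continuous_const continuous_abs).measurableSet

theorem measurable_superlevelExp (β p : ℝ) : Measurable (superlevelExp β p) :=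
  Measurable.indicator (by fun_prop) measurableSet_one_lt_abs

theorem superlevelExp_mul_le_liminf {ι : Type*} {l : Filter ι} [l.NeBot] {β p : ℝ} (hp : 0 ≤ p)
    {f : ι → ℝ} {s : ℝ} (hf : Tendsto f l (𝓝 s)) {m : ℝ≥0∞} (hm : m ≠ ∞) :
    superlevelExp β p s * m ≤ liminf (fun i ↦ superlevelExp β p (f i) * m) l := by
  by_cases hs : 1 < |s|
  · have hF : Tendsto (fun i ↦ superlevelExp β p (f i)) l (𝓝 (superlevelExp β p s)) := by
      have hc : Continuous fun s : ℝ ↦ ENNReal.ofReal (exp (β * (|s| - 1) ^ p)) :=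
        ENNReal.continuous_ofReal.comp (continuous_exp.comp (continuous_const.mul
          ((continuous_abs.sub continuous_const).rpow_const fun _ ↦ Or.inr hp)))
      have hs' : superlevelExp β p s = ENNReal.ofReal (exp (β * (|s| - 1) ^ p)) :=
        indicator_of_mem (by exact hs) _
      rw [hs']
      refine ((hc.tendsto s).comp hf).congr' ?_
      filter_upwards [hf.abs.eventually_const_lt hs] with i hi
      exact (indicator_of_mem (s := {s : ℝ | 1 < |s|}) (f := fun s ↦
        ENNReal.ofReal (exp (β * (|s| - 1) ^ p))) hi).symm
    exact (ENNReal.Tendsto.mul_const hF (Or.inr hm)).liminf_eq.ge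
  · have : superlevelExp β p s = 0 := indicator_of_notMem (by exact hs) _
    simp [this]

theorem exists_contDiffBump_seq : ∃ φ : ℕ → ContDiffBump (0 : 𝔼),
    Tendsto (fun k ↦ (φ k).rOut) atTop (𝓝 0) ∧ ∀ k, (φ k).rOut ≤ 2 * (φ k).rIn := by
  refine ⟨fun k ↦ ⟨1 / ((k : ℝ) + 1), 2 * (1 / ((k : ℝ) + 1)), by positivity, ?_⟩, ?_, fun k ↦ le_rfl⟩
  · have : 0 < 1 / ((k : ℝ) + 1) := by positivity
    linarith
  · simpa using (tendsto_one_div_add_atTop_nhds_zero_nat (𝕜 := ℝ)).const_mul 2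

/-- The Moser–Trudinger bound on the superlevel set `{1 < |u|}` for functions with a weak
gradient. -/
theorem exists_lintegral_superlevelExp_le (hN : 2 ≤ N) {t β : ℝ} (ht0 : 0 ≤ t) (htN : t < N)
    (hβ0 : 0 < β) (hβ : β < ((N : ℝ) - t) * sphereArea N ^ (1 / ((N : ℝ) - 1))) :
    ∃ C : ℝ≥0∞, C ≠ ∞ ∧ ∀ (u : 𝔼 → ℝ) (g : 𝔼 → 𝔼) (M : ℝ), HasWeakGradient u g → 0 < M →
      ∫⁻ x, ‖g x‖ₑ ^ (N : ℝ) ≤ 1 →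
      ∫⁻ x, ‖u x‖ₑ ^ (N : ℝ) * ENNReal.ofReal (‖x‖ ^ (-t)) ≤ ENNReal.ofReal M →
      ∫⁻ x, superlevelExp β ((N : ℝ) / ((N : ℝ) - 1)) (u x) * ENNReal.ofReal (‖x‖ ^ (-t)) ≤
        C * ENNReal.ofReal M := by
  have : NeZero N := ⟨by omega⟩
  have hN' : (2 : ℝ) ≤ N := by exact_mod_cast hN
  have hN1 : (1 : ℝ) < N := by linarith
  obtain ⟨C₁, hC₁, h₁⟩ := exists_lintegral_superlevel_le_mul hN ht0 htN hβ0 hβ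
  obtain ⟨C₀, hC₀, h₀⟩ := exists_lintegral_normed_mul_norm_rpow_le (N := N) ht0 htN
  obtain ⟨φ, hφ, hφ2⟩ := exists_contDiffBump_seq (N := N)
  refine ⟨C₁ * ENNReal.ofReal (C₀.toReal + 1), ENNReal.mul_ne_top hC₁ ENNReal.ofReal_ne_top,
    fun u g M hug hM hg hu ↦ ?_⟩
  have hC₀1 : 0 < C₀.toReal + 1 := by positivity
  set p := (N : ℝ) / ((N : ℝ) - 1) with hp
  have hp0 : 0 ≤ p := div_nonneg (by linarith) (by linarith)
  have hwm : Measurable fun x : 𝔼 ↦ ENNReal.ofReal (‖x‖ ^ (-t)) := by fun_prop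
  set w : ℕ → 𝔼 → ℝ := fun k ↦ (φ k).normed volume ⋆[ContinuousLinearMap.lsmul ℝ ℝ, volume] u
    with hw
  have hwC : ∀ k, ContDiff ℝ 1 (w k) := fun k ↦
    (φ k).hasCompactSupport_normed.contDiff_convolution_left _ (n := 1) (φ k).contDiff_normed hug.1
  have hkm : ∀ k, Measurable fun x ↦ ENNReal.ofReal ((φ k).normed volume x) := fun k ↦
    (φ k).continuous_normed.measurable.ennreal_ofReal
  have hgrad : ∀ k, ∫⁻ x, ‖fderiv ℝ (w k) x‖ₑ ^ (N : ℝ) ≤ 1 := fun k ↦ by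
    have h := lintegral_convolution_rpow_mul_le hN1 hug.2.1.aestronglyMeasurable.enorm (hkm k)
      (φ k).lintegral_ofReal_normed (measurable_const (a := (1 : ℝ≥0∞)))
    simp only [mul_one, lintegral_sub_right_eq_self (fun x ↦
      ENNReal.ofReal ((φ k).normed volume x)), (φ k).lintegral_ofReal_normed] at h
    refine (lintegral_mono fun x ↦ ?_).trans (h.trans hg)
    gcongr
    rw [hw, hug.fderiv_convolution (φ k).contDiff_normed (φ k).hasCompactSupport_normed,
      ← ofReal_norm, innerSL_apply_norm, ofReal_norm]
    refine (enorm_integral_le_lintegral_enorm _).trans_eq (lintegral_congr fun y ↦ ?_)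
    rw [enorm_smul, Real.enorm_of_nonneg ((φ k).nonneg_normed _), mul_comm]
  have hmass : ∀ k, ∫⁻ x in {x | 1 < |w k x|}, ENNReal.ofReal (‖x‖ ^ (-t)) ≤
      ENNReal.ofReal ((C₀.toReal + 1) * M) := fun k ↦ by
    have hwk : ∀ x, ‖w k x‖ₑ ≤
        ∫⁻ y, ‖u y‖ₑ * ENNReal.ofReal ((φ k).normed volume (x - y)) := fun x ↦ by
      simp only [hw, convolution_eq_swap]
      refine (enorm_integral_le_lintegral_enorm _).trans_eq (lintegral_congr fun y ↦ ?_)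
      rw [ContinuousLinearMap.lsmul_apply, enorm_smul,
        Real.enorm_of_nonneg ((φ k).nonneg_normed _), mul_comm]
    have hAm : MeasurableSet {x | 1 < |w k x|} :=
      (isOpen_lt continuous_const (hwC k).continuous.abs).measurableSet
    calc _ ≤ ∫⁻ x in {x | 1 < |w k x|}, ‖w k x‖ₑ ^ (N : ℝ) * ENNReal.ofReal (‖x‖ ^ (-t)) := by
          refine setLIntegral_mono' hAm fun x hx ↦ ?_
          refine le_mul_of_one_le_left zero_le (ENNReal.one_le_rpow ?_ (by linarith))
          rw [← ofReal_norm, Real.norm_eq_abs, ENNReal.one_le_ofReal]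
          exact le_of_lt hx
      _ ≤ ∫⁻ x, (∫⁻ y, ‖u y‖ₑ * ENNReal.ofReal ((φ k).normed volume (x - y))) ^ (N : ℝ) *
          ENNReal.ofReal (‖x‖ ^ (-t)) := by
          refine (setLIntegral_le_lintegral _ _).trans (lintegral_mono fun x ↦ ?_)
          gcongr
          exact hwk x
      _ ≤ ∫⁻ y, ‖u y‖ₑ ^ (N : ℝ) * ∫⁻ x, ENNReal.ofReal ((φ k).normed volume (x - y)) *
          ENNReal.ofReal (‖x‖ ^ (-t)) :=
          lintegral_convolution_rpow_mul_le hN1 hug.1.aestronglyMeasurable.enorm (hkm k)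
            (φ k).lintegral_ofReal_normed hwm
      _ ≤ ∫⁻ y, C₀ * (‖u y‖ₑ ^ (N : ℝ) * ENNReal.ofReal (‖y‖ ^ (-t))) := by
          refine lintegral_mono_ae ?_
          filter_upwards [compl_mem_ae_iff.2 (measure_singleton (0 : 𝔼))] with y hy
          rw [mul_left_comm]
          gcongr
          exact h₀ (φ k) (hφ2 k) y hy
      _ ≤ C₀ * ENNReal.ofReal M := by
          rw [lintegral_const_mul' _ _ hC₀]
          gcongr
      _ ≤ _ := by
          rw [ENNReal.ofReal_mul hC₀1.le]
          gcongr
          rw [ENNReal.le_ofReal_iff_toReal_le hC₀ hC₀1.le]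
          linarith
  calc _ ≤ ∫⁻ x, liminf (fun k ↦ superlevelExp β p (w k x) * ENNReal.ofReal (‖x‖ ^ (-t))) atTop := by
        refine lintegral_mono_ae ?_
        filter_upwards [ContDiffBump.ae_convolution_tendsto_right_of_locallyIntegrable hφ
          (.of_forall hφ2) hug.1] with x hx
        exact superlevelExp_mul_le_liminf hp0 hx ENNReal.ofReal_ne_top
    _ ≤ liminf (fun k ↦ ∫⁻ x, superlevelExp β p (w k x) * ENNReal.ofReal (‖x‖ ^ (-t))) atTop :=
        lintegral_liminf_le fun k ↦
          ((measurable_superlevelExp β p).comp (hwC k).continuous.measurable).mul hwm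
    _ ≤ _ := by
        refine liminf_le_of_le (by isBoundedDefault) fun b hb ↦ ?_
        obtain ⟨k, hk⟩ := hb.exists
        refine hk.trans ?_
        rw [mul_assoc, ← ENNReal.ofReal_mul hC₀1.le]
        refine le_of_eq_of_le ?_ (h₁ (w k) _ (hwC k) (by positivity) (hgrad k) (hmass k))
        rw [← lintegral_indicator
          (isOpen_lt continuous_const (hwC k).continuous.abs).measurableSet]
        refine lintegral_congr fun x ↦ ?_
        by_cases hx : 1 < |w k x| <;> simp [superlevelExp, indicator, hx]

end Approximation

section Pointwise

open Set
open scoped ENNReal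

theorem rpow_natCast_le_mul_exp {c s p : ℝ} (N : ℕ) (hc : 0 < c) (hp : 1 ≤ p) (hs : 1 ≤ s) :
    s ^ (N : ℝ) ≤ N.factorial / c ^ N * exp (c * s ^ p) := by
  have hsp : s ≤ s ^ p := by
    nth_rewrite 1 [← rpow_one s]
    exact rpow_le_rpow_of_exponent_le hs hp
  have h := pow_div_factorial_le_exp (c * s) (by positivity) N
  have hexp : exp (c * s) ≤ exp (c * s ^ p) := exp_le_exp.2 (by gcongr)
  rw [rpow_natCast]
  rw [mul_pow, div_le_iff₀ (by positivity)] at h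
  rw [div_mul_eq_mul_div, le_div_iff₀ (by positivity)]
  nlinarith [mul_le_mul_of_nonneg_right hexp (Nat.cast_nonneg (α := ℝ) N.factorial)]

theorem exists_exp_mul_rpow_le {α β p : ℝ} (N : ℕ) (hα : 0 < α) (hαβ : α < β) (hp : 1 < p) :
    ∃ K : ℝ, 0 ≤ K ∧ ∀ s : ℝ, 1 ≤ s →
      exp (α * s ^ p) * s ^ (N : ℝ) ≤ K * exp (β * (s - 1) ^ p) := by
  set c := (β - α) / 2 with hc
  have hc0 : 0 < c := by rw [hc]; linarith
  have hαc : 0 < α + c := by linarith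
  obtain ⟨D, hD0, hD⟩ := exists_one_add_rpow_le hp (ε := β / (α + c) - 1) (by
    rw [sub_pos, one_lt_div hαc]; linarith)
  refine ⟨N.factorial / c ^ N * exp ((α + c) * D), by positivity, fun s hs ↦ ?_⟩
  have h1 : (α + c) * s ^ p ≤ β * (s - 1) ^ p + (α + c) * D := by
    have h := hD (s - 1) (by linarith)
    rw [add_sub_cancel, add_sub_cancel] at h
    calc _ ≤ (α + c) * (β / (α + c) * (s - 1) ^ p + D) := by gcongr
      _ = _ := by field_simp
  calc _ ≤ exp (α * s ^ p) * (N.factorial / c ^ N * exp (c * s ^ p)) := by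
        gcongr
        exact rpow_natCast_le_mul_exp N hc0 hp.le hs
    _ = N.factorial / c ^ N * exp ((α + c) * s ^ p) := by rw [add_mul, exp_add]; ring
    _ ≤ N.factorial / c ^ N * exp (β * (s - 1) ^ p + (α + c) * D) := by gcongr
    _ = _ := by rw [exp_add]; ring

/-- Splitting the integrand according to whether `|s| ≤ 1`. -/
theorem ofReal_exp_mul_rpow_le {α β p K : ℝ} {N : ℕ} (hα : 0 < α) (hp : 0 ≤ p) (hK0 : 0 ≤ K)
    (hK : ∀ s : ℝ, 1 ≤ s → exp (α * s ^ p) * s ^ (N : ℝ) ≤ K * exp (β * (s - 1) ^ p)) (s : ℝ) :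
    ENNReal.ofReal (exp (α * |s| ^ p) * |s| ^ (N : ℝ)) ≤
      ENNReal.ofReal (exp α) * ENNReal.ofReal (|s| ^ (N : ℝ)) +
        ENNReal.ofReal K * superlevelExp β p s := by
  rcases le_or_gt |s| 1 with hs | hs
  · refine le_trans ?_ le_self_add
    rw [← ENNReal.ofReal_mul (exp_pos _).le]
    refine ENNReal.ofReal_le_ofReal ?_
    gcongr
    exact mul_le_of_le_one_right hα.le (rpow_le_one (abs_nonneg s) hs hp)
  · refine le_trans ?_ le_add_self
    rw [superlevelExp, indicator_of_mem (by exact hs), ← ENNReal.ofReal_mul hK0]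
    exact ENNReal.ofReal_le_ofReal (hK _ hs.le)

end Pointwise

end

/-- **Exponentially weighted Moser–Trudinger inequality, special case `s = t`
(inequality (4.1)).** For `N ≥ 2`, `0 ≤ t < N` and `0 < α < α_{N,t} = (N-t)·ω_{N-1}^{1/(N-1)}`,
there is `C > 0` such that for every `u ∈ L^N(ℝ^N;|x|^{-t}dx) ∩ Ẇ^{1,N}(ℝ^N)` with
`∫|∇u|^N ≤ 1`, `∫ e^{α|u|^{N/(N-1)}}|u|^N|x|^{-t} dx ≤ C ∫ |u|^N |x|^{-t} dx`. -/
theorem weighted_moser_trudinger_exp_eq_weights (N : ℕ) (hN : 2 ≤ N) (t : ℝ) (ht0 : 0 ≤ t)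
    (htN : t < (N : ℝ)) (α : ℝ) (hα0 : 0 < α)
    (hα : α < ((N : ℝ) - t) * sphereArea N ^ (1 / ((N : ℝ) - 1))) :
    ∃ C : ℝ, 0 < C ∧
      ∀ (u : EuclideanSpace ℝ (Fin N) → ℝ)
        (g : EuclideanSpace ℝ (Fin N) → EuclideanSpace ℝ (Fin N)),
        HasWeakGradient u g →
        (∫⁻ x, ENNReal.ofReal (|u x| ^ (N : ℝ) * ‖x‖ ^ (-t))) ≠ ⊤ →
        (∫⁻ x, ENNReal.ofReal (‖g x‖ ^ (N : ℝ))) ≤ 1 →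
        (∫⁻ x, ENNReal.ofReal
            (Real.exp (α * |u x| ^ ((N : ℝ) / ((N : ℝ) - 1))) * |u x| ^ (N : ℝ) * ‖x‖ ^ (-t)))
          ≤ ENNReal.ofReal C * ∫⁻ x, ENNReal.ofReal (|u x| ^ (N : ℝ) * ‖x‖ ^ (-t)) := by
  have hN' : (2 : ℝ) ≤ N := by exact_mod_cast hN
  obtain ⟨β, hαβ, hβ⟩ := exists_between hα
  set p := (N : ℝ) / ((N : ℝ) - 1) with hp
  have hp1 : 1 < p := by rw [hp, one_lt_div (by linarith)]; linarith
  obtain ⟨C₁, hC₁, h₁⟩ := exists_lintegral_superlevelExp_le hN ht0 htN (hα0.trans hαβ) hβ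
  obtain ⟨K, hK0, hK⟩ := exists_exp_mul_rpow_le N hα0 hαβ hp1
  refine ⟨exp α + K * C₁.toReal, by positivity, fun u g hug hu hg ↦ ?_⟩
  set m := ∫⁻ x, ENNReal.ofReal (|u x| ^ (N : ℝ) * ‖x‖ ^ (-t)) with hm
  have hmul : ∀ x, ENNReal.ofReal (|u x| ^ (N : ℝ) * ‖x‖ ^ (-t)) =
      ENNReal.ofReal (|u x| ^ (N : ℝ)) * ENNReal.ofReal (‖x‖ ^ (-t)) := fun x ↦
    ENNReal.ofReal_mul (by positivity)
  have hsuper : ∫⁻ x, superlevelExp β p (u x) * ENNReal.ofReal (‖x‖ ^ (-t)) ≤ C₁ * m := by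
    have hlim : Filter.Tendsto (fun k : ℕ ↦ C₁ * ENNReal.ofReal (m.toReal + 1 / ((k : ℝ) + 1)))
        Filter.atTop (nhds (C₁ * m)) := by
      refine ENNReal.Tendsto.const_mul ?_ (Or.inr hC₁)
      nth_rewrite 2 [← ENNReal.ofReal_toReal hu]
      refine ENNReal.tendsto_ofReal ?_
      simpa using (tendsto_one_div_add_atTop_nhds_zero_nat (𝕜 := ℝ)).const_add m.toReal
    refine ge_of_tendsto' hlim fun k ↦ h₁ u g _ hug (by positivity) ?_ ?_
    · refine (lintegral_congr fun x ↦ ?_).trans_le hg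
      rw [← ofReal_norm, ENNReal.ofReal_rpow_of_nonneg (norm_nonneg _) (by positivity)]
    · calc _ = m := by
            refine lintegral_congr fun x ↦ ?_
            rw [hmul, ← ofReal_norm, ENNReal.ofReal_rpow_of_nonneg (norm_nonneg _) (by positivity),
              Real.norm_eq_abs]
        _ = ENNReal.ofReal m.toReal := (ENNReal.ofReal_toReal hu).symm
        _ ≤ _ := ENNReal.ofReal_le_ofReal (le_add_of_nonneg_right (by positivity))
  have hmeas : AEMeasurable fun x ↦ ENNReal.ofReal (|u x| ^ (N : ℝ) * ‖x‖ ^ (-t)) := by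
    have := hug.1.aestronglyMeasurable.aemeasurable
    fun_prop
  calc _ ≤ ∫⁻ x, (ENNReal.ofReal (exp α) * ENNReal.ofReal (|u x| ^ (N : ℝ) * ‖x‖ ^ (-t)) +
        ENNReal.ofReal K * (superlevelExp β p (u x) * ENNReal.ofReal (‖x‖ ^ (-t)))) := by
        refine lintegral_mono fun x ↦ ?_
        rw [ENNReal.ofReal_mul (by positivity), hmul, ← mul_assoc, ← mul_assoc, ← add_mul]
        gcongr
        exact ofReal_exp_mul_rpow_le hα0 (by linarith) hK0 hK (u x)
    _ = ENNReal.ofReal (exp α) * m + ENNReal.ofReal K *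
        ∫⁻ x, superlevelExp β p (u x) * ENNReal.ofReal (‖x‖ ^ (-t)) := by
        rw [lintegral_add_left' (hmeas.const_mul _), lintegral_const_mul' _ _ ENNReal.ofReal_ne_top,
          lintegral_const_mul' _ _ ENNReal.ofReal_ne_top]
    _ ≤ ENNReal.ofReal (exp α) * m + ENNReal.ofReal K * (C₁ * m) := by gcongr
    _ = _ := by
        rw [ENNReal.ofReal_add (exp_pos _).le (by positivity), ENNReal.ofReal_mul hK0,
          ENNReal.ofReal_toReal hC₁]
        ring
end

section
/- Let N ≥ 2, let q ≥ N, and let s, t be real numbers with -∞ < s < t < N. Set a := (t-s)/(N-s), so that 1 - a = (N-t)/(N-s). Then there exists a constant C > 0 such that for all u ∈ C_0^∞(ℝ^N): (∫_{ℝ^N} |u(x)|^q |x|^{-t} dx)^{1/q} ≤ C (∫_{ℝ^N} |∇u(x)|^N dx)^{a/N} (∫_{ℝ^N} |u(x)|^q |x|^{-s} dx)^{(1-a)/q}. -/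
open MeasureTheory Real

section HaarMeasure

open Module Metric
open scoped ENNReal NNReal

variable {E : Type*} [NormedAddCommGroup E] [NormedSpace ℝ E] [FiniteDimensional ℝ E]
  [MeasurableSpace E] [BorelSpace E] (μ : Measure E) [μ.IsAddHaarMeasure]

theorem setLIntegral_closedBall_rpow_norm_lt_top (hE : 1 ≤ finrank ℝ E) {α : ℝ}
    (hα : α < finrank ℝ E) (R : ℝ) :
    ∫⁻ x in closedBall (0 : E) R, ENNReal.ofReal (‖x‖ ^ (-α)) ∂μ < ∞ := by
  have hloc : LocallyIntegrable (fun x : E ↦ ‖x‖ ^ (-α)) μ := by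
    refine locallyIntegrable_of_norm_le_rpow (C := 1) hE hα (.of_forall fun x ↦ ?_) ?_
    · rw [Real.norm_of_nonneg (by positivity), one_mul]
    · exact (measurable_norm.pow_const _).aestronglyMeasurable
  exact (hloc.integrableOn_isCompact (isCompact_closedBall 0 R)).lintegral_lt_top

theorem lintegral_comp_smul_of_pos (f : E → ℝ≥0∞) {R : ℝ} (hR : 0 < R) :
    ∫⁻ x, f (R • x) ∂μ = ENNReal.ofReal (R ^ (-(finrank ℝ E : ℝ))) * ∫⁻ x, f x ∂μ := by
  calc
    ∫⁻ x, f (R • x) ∂μ = ∫⁻ y, f y ∂Measure.map (fun x : E ↦ R • x) μ :=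
      (lintegral_map_equiv f
        (Homeomorph.smul (isUnit_iff_ne_zero.2 hR.ne').unit).toMeasurableEquiv).symm
    _ = _ := by
      rw [Measure.map_addHaar_smul μ hR.ne', lintegral_smul_measure, abs_of_pos (by positivity),
        rpow_neg hR.le, rpow_natCast, smul_eq_mul]

theorem exists_eLpNorm_bump_mul_le (f : ContDiffBump (0 : E)) {p m : ℝ≥0} {q : ℝ≥0∞} (hp : 1 ≤ p)
    (hpE : p < finrank ℝ E) (hpm : (p : ℝ)⁻¹ - (finrank ℝ E : ℝ)⁻¹ ≤ (m : ℝ)⁻¹) (hpq : p ≤ q) :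
    ∃ K : ℝ≥0, ∀ u : E → ℝ, ContDiff ℝ 1 u →
      eLpNorm (fun x ↦ f x * u x) m μ ≤ K * (eLpNorm (fderiv ℝ u) (finrank ℝ E) μ +
        eLpNorm u q (μ.restrict (closedBall 0 f.rOut \ ball 0 f.rIn))) := by
  set B : Set E := closedBall 0 f.rOut
  set A : Set E := B \ ball 0 f.rIn
  have hBm : MeasurableSet B := isClosed_closedBall.measurableSet
  have hAm : MeasurableSet A := hBm.diff isOpen_ball.measurableSet
  have hBf : μ B < ∞ := measure_closedBall_lt_top
  have hAf : μ A < ∞ := (measure_mono Set.sdiff_subset).trans_lt hBf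
  have hf : ContDiff ℝ 1 f := f.contDiff
  obtain ⟨M, hM⟩ := (hf.continuous_fderiv one_ne_zero).bounded_above_of_compact_support
    (f.hasCompactSupport.fderiv ℝ)
  have hM0 : 0 ≤ M := (norm_nonneg _).trans (hM 0)
  have hpN : (p : ℝ≥0∞) ≤ (finrank ℝ E : ℝ≥0∞) := by exact_mod_cast hpE.le
  set c : ℝ≥0 := eLpNormLESNormFDerivOfLeConst ℝ μ B p m
  set a : ℝ≥0∞ := (μ.restrict B) Set.univ ^
    (1 / (p : ℝ≥0∞).toReal - 1 / (finrank ℝ E : ℝ≥0∞).toReal)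
  set b : ℝ≥0∞ := (μ.restrict A) Set.univ ^ (1 / (p : ℝ≥0∞).toReal - 1 / q.toReal)
  have hp0 : 0 < (p : ℝ) := by exact_mod_cast zero_lt_one.trans_le hp
  have ha : a ≠ ∞ := by
    refine ENNReal.rpow_ne_top_of_nonneg ?_ (by simpa using hBf.ne)
    rw [sub_nonneg]
    refine one_div_le_one_div_of_le (by simpa using hp0) ?_
    simpa using (show (p : ℝ) ≤ finrank ℝ E by exact_mod_cast hpE.le)
  have hb : b ≠ ∞ := by
    refine ENNReal.rpow_ne_top_of_nonneg ?_ (by simpa using hAf.ne)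
    rw [sub_nonneg]
    rcases eq_or_ne q ∞ with rfl | hq
    · simp
    · exact one_div_le_one_div_of_le (by simpa using hp0) (ENNReal.toReal_mono hq hpq)
  refine ⟨c * (a + ENNReal.ofReal M * b).toNNReal, fun u hu ↦ ?_⟩
  have hK : ((a + ENNReal.ofReal M * b).toNNReal : ℝ≥0∞) = a + ENNReal.ofReal M * b :=
    ENNReal.coe_toNNReal (by finiteness)
  have hum : Continuous (fderiv ℝ u) := hu.continuous_fderiv one_ne_zero
  have hpt : ∀ x, ‖fderiv ℝ (fun x ↦ f x * u x) x‖ ≤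
      ((B.indicator fun x ↦ ‖fderiv ℝ u x‖) + A.indicator fun x ↦ M * ‖u x‖) x := by
    intro x
    have h1 : ‖f x • fderiv ℝ u x‖ ≤ B.indicator (fun x ↦ ‖fderiv ℝ u x‖) x := by
      by_cases hx : x ∈ B
      · rw [Set.indicator_of_mem hx, norm_smul, Real.norm_of_nonneg f.nonneg]
        exact mul_le_of_le_one_left (norm_nonneg _) f.le_one
      · rw [Set.indicator_of_notMem hx, f.zero_of_le_dist, zero_smul, norm_zero]
        exact (not_le.1 hx).le
    have h2 : ‖u x • fderiv ℝ f x‖ ≤ A.indicator (fun x ↦ M * ‖u x‖) x := by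
      by_cases hx : x ∈ A
      · rw [Set.indicator_of_mem hx, norm_smul, mul_comm]
        gcongr
        exact hM x
      · rw [Set.indicator_of_notMem hx]
        suffices fderiv ℝ f x = 0 by simp [this]
        by_cases hxB : x ∈ B
        · have hx' : x ∈ ball (0 : E) f.rIn := by
            by_contra h
            exact hx ⟨hxB, h⟩
          rw [(f.eventuallyEq_one_of_mem_ball hx').fderiv_eq]
          simp
        · refine image_eq_zero_of_notMem_tsupport fun h ↦ hxB ?_
          have := tsupport_fderiv_subset ℝ h
          rwa [f.tsupport_eq] at this
    rw [fderiv_fun_mul (hf.differentiable one_ne_zero x) (hu.differentiable one_ne_zero x)]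
    exact (norm_add_le _ _).trans (add_le_add h1 h2)
  have hsupp : Function.support (fun x ↦ f x * u x) ⊆ B := by
    refine (Function.support_mul_subset_left _ _).trans ?_
    rw [f.support_eq]
    exact ball_subset_closedBall
  calc
    eLpNorm (fun x ↦ f x * u x) m μ ≤ c * eLpNorm (fderiv ℝ fun x ↦ f x * u x) p μ :=
      eLpNorm_le_eLpNorm_fderiv_of_le μ (hf.mul hu) hsupp hp hpE hpm isBounded_closedBall
    _ ≤ c * (eLpNorm (fderiv ℝ u) p (μ.restrict B) +
          ENNReal.ofReal M * eLpNorm u p (μ.restrict A)) := by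
      gcongr
      refine (eLpNorm_mono_real hpt).trans ((eLpNorm_add_le ?_ ?_ ?_).trans_eq ?_)
      · exact (hum.norm.measurable.indicator hBm).aestronglyMeasurable
      · exact ((hu.continuous.norm.measurable.const_mul M).indicator hAm).aestronglyMeasurable
      · exact_mod_cast hp
      · rw [eLpNorm_indicator_eq_eLpNorm_restrict hBm, eLpNorm_indicator_eq_eLpNorm_restrict hAm,
          eLpNorm_norm]
        congr 1
        rw [← eLpNorm_norm u]
        have := eLpNorm_const_smul M (fun x ↦ ‖u x‖) p (μ.restrict A)
        rw [Real.enorm_of_nonneg hM0] at this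
        exact this
    _ ≤ c * (eLpNorm (fderiv ℝ u) (finrank ℝ E) (μ.restrict B) * a +
          ENNReal.ofReal M * (eLpNorm u q (μ.restrict A) * b)) := by
      gcongr
      · exact eLpNorm_le_eLpNorm_mul_rpow_measure_univ hpN hum.aestronglyMeasurable
      · exact eLpNorm_le_eLpNorm_mul_rpow_measure_univ hpq hu.continuous.aestronglyMeasurable
    _ ≤ c * (eLpNorm (fderiv ℝ u) (finrank ℝ E) μ * (a + ENNReal.ofReal M * b) +
          eLpNorm u q (μ.restrict A) * (a + ENNReal.ofReal M * b)) := by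
      rw [mul_left_comm (ENNReal.ofReal M)]
      gcongr
      · exact Measure.restrict_le_self
      · exact le_self_add
      · exact le_add_self
    _ = _ := by
      rw [ENNReal.coe_mul, hK]
      ring

theorem eLpNorm_ofReal_rpow {X F : Type*} [MeasurableSpace X] [NormedAddCommGroup F]
    (ν : Measure X) (g : X → F) {q : ℝ} (hq : 0 < q) :
    eLpNorm g (ENNReal.ofReal q) ν ^ q = ∫⁻ x, ENNReal.ofReal (‖g x‖ ^ q) ∂ν := by
  rw [eLpNorm_eq_lintegral_rpow_enorm_toReal (by simpa using hq) ENNReal.ofReal_ne_top,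
    ENNReal.toReal_ofReal hq.le, ← ENNReal.rpow_mul, one_div_mul_cancel hq.ne', ENNReal.rpow_one]
  simp_rw [← ENNReal.ofReal_rpow_of_nonneg (norm_nonneg _) hq.le, ofReal_norm]

/-- The weighted integral `∫ |u|^q |x|^{-t}`. -/
noncomputable def weightedLIntegral (u : E → ℝ) (q t : ℝ) : ℝ≥0∞ :=
  ∫⁻ x, ENNReal.ofReal (|u x| ^ q * ‖x‖ ^ (-t)) ∂μ

/-- The integral `∫ |∇u|^d`, where `d` is the dimension of the space. -/
noncomputable def gradientLIntegral (u : E → ℝ) : ℝ≥0∞ :=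
  ∫⁻ x, ENNReal.ofReal (‖fderiv ℝ u x‖ ^ (finrank ℝ E : ℝ)) ∂μ

theorem exists_setLIntegral_closedBall_le (hE : 2 ≤ finrank ℝ E) {q t : ℝ}
    (hq : (finrank ℝ E : ℝ) ≤ q) (ht : t < finrank ℝ E) (f : ContDiffBump (0 : E)) :
    ∃ K : ℝ≥0, ∀ u : E → ℝ, ContDiff ℝ 1 u →
      ∫⁻ x in closedBall 0 f.rIn, ENNReal.ofReal (|u x| ^ q * ‖x‖ ^ (-t)) ∂μ ≤
        K * (gradientLIntegral μ u ^ (q / finrank ℝ E) +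
          ∫⁻ x in closedBall 0 f.rOut \ ball 0 f.rIn, ENNReal.ofReal (|u x| ^ q) ∂μ) := by
  have hd2 : (2 : ℝ) ≤ finrank ℝ E := by exact_mod_cast hE
  have hd : (0 : ℝ) < finrank ℝ E := by linarith
  have hq1 : 1 ≤ q := by linarith
  have hq0 : 0 < q := by linarith
  obtain ⟨r', htr', hr'⟩ : ∃ r' : ℝ, t * r' < finrank ℝ E ∧ 1 < r' := by
    have h : ∀ᶠ y in nhdsWithin (1 : ℝ) (Set.Ioi 1), t * y < finrank ℝ E := by
      refine (ContinuousAt.eventually_lt (by fun_prop) continuousAt_const ?_).filter_mono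
        nhdsWithin_le_nhds
      simpa using ht
    exact (h.and self_mem_nhdsWithin).exists
  set r := r'.conjExponent
  have hrr : r.HolderConjugate r' := (Real.HolderConjugate.conjExponent hr').symm
  have hr0 : 0 < r := hrr.pos
  have hr'0 : 0 < r' := hrr.symm.pos
  have hm : 0 < q * r := by positivity
  set e : ℝ := min 1 ((finrank ℝ E : ℝ)⁻¹ + (q * r)⁻¹)
  have hde : (finrank ℝ E : ℝ)⁻¹ < e := by
    refine lt_min (inv_lt_one_of_one_lt₀ (by linarith)) ?_
    linarith [inv_pos.2 hm]
  have he0 : 0 < e := (inv_pos.2 hd).trans hde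
  have hp1 : 1 ≤ e⁻¹ := (one_le_inv₀ he0).2 (min_le_left _ _)
  have hpd : e⁻¹ < finrank ℝ E := inv_lt_of_inv_lt₀ hd hde
  obtain ⟨K, hK⟩ := exists_eLpNorm_bump_mul_le μ f (p := e⁻¹.toNNReal) (m := (q * r).toNNReal)
    (q := ENNReal.ofReal q) (by rwa [Real.one_le_toNNReal])
    (by rwa [← NNReal.coe_lt_coe, Real.coe_toNNReal _ (inv_pos.2 he0).le, NNReal.coe_natCast])
    (by
      rw [Real.coe_toNNReal _ (inv_pos.2 he0).le, Real.coe_toNNReal _ hm.le, inv_inv]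
      linarith [min_le_right 1 ((finrank ℝ E : ℝ)⁻¹ + (q * r)⁻¹)])
    (ENNReal.ofReal_le_ofReal (hpd.le.trans hq))
  set B : Set E := closedBall 0 f.rIn
  set A : Set E := closedBall 0 f.rOut \ ball 0 f.rIn
  set I : ℝ≥0∞ := (∫⁻ x in B, ENNReal.ofReal (‖x‖ ^ (-t)) ^ r' ∂μ) ^ (1 / r')
  have hI' : I ≠ ∞ := by
    refine ENNReal.rpow_ne_top_of_nonneg (by positivity) ?_
    convert (setLIntegral_closedBall_rpow_norm_lt_top μ (by lia) htr' f.rIn).ne using 4 with x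
    rw [ENNReal.ofReal_rpow_of_nonneg (by positivity) hr'0.le, ← Real.rpow_mul (norm_nonneg _),
      neg_mul]
  refine ⟨((K : ℝ≥0∞) ^ q * 2 ^ (q - 1) * I).toNNReal, fun u hu ↦ ?_⟩
  rw [ENNReal.coe_toNNReal (by finiteness)]
  set v : E → ℝ := fun x ↦ f x * u x
  have hv : Continuous v := f.continuous.mul hu.continuous
  calc
    ∫⁻ x in B, ENNReal.ofReal (|u x| ^ q * ‖x‖ ^ (-t)) ∂μ
      = ∫⁻ x in B, ((fun x : E ↦ ENNReal.ofReal (|v x| ^ q)) *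
          fun x : E ↦ ENNReal.ofReal (‖x‖ ^ (-t)) : E → ℝ≥0∞) x ∂μ := by
      refine setLIntegral_congr_fun isClosed_closedBall.measurableSet fun x hx ↦ ?_
      simp only [v, f.one_of_mem_closedBall hx, one_mul, Pi.mul_apply]
      rw [ENNReal.ofReal_mul (by positivity)]
    _ ≤ (∫⁻ x in B, ENNReal.ofReal (|v x| ^ q) ^ r ∂μ) ^ (1 / r) * I := by
      refine ENNReal.lintegral_mul_le_Lp_mul_Lq _ hrr ?_ ?_
      · exact (hv.measurable.abs.pow_const _).ennreal_ofReal.aemeasurable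
      · exact (measurable_norm.pow_const _).ennreal_ofReal.aemeasurable
    _ ≤ (∫⁻ x, ENNReal.ofReal (|v x| ^ q) ^ r ∂μ) ^ (1 / r) * I := by
      gcongr
      exact Measure.restrict_le_self
    _ = eLpNorm v (q * r).toNNReal μ ^ q * I := by
      congr 1
      simp_rw [ENNReal.ofReal_rpow_of_nonneg (rpow_nonneg (abs_nonneg _) q) hr0.le,
        ← Real.rpow_mul (abs_nonneg _), ← Real.norm_eq_abs]
      rw [← eLpNorm_ofReal_rpow μ v hm, ← ENNReal.rpow_mul]
      congr 1
      field_simp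
    _ ≤ (K * (eLpNorm (fderiv ℝ u) (finrank ℝ E) μ +
          eLpNorm u (ENNReal.ofReal q) (μ.restrict A))) ^ q * I := by
      gcongr
      exact hK u hu
    _ ≤ (K ^ q * (2 ^ (q - 1) * (eLpNorm (fderiv ℝ u) (finrank ℝ E) μ ^ q +
          eLpNorm u (ENNReal.ofReal q) (μ.restrict A) ^ q))) * I := by
      rw [ENNReal.mul_rpow_of_nonneg _ _ hq0.le]
      gcongr
      exact ENNReal.rpow_add_le_mul_rpow_add_rpow _ _ hq1
    _ = _ := by
      rw [eLpNorm_ofReal_rpow _ u hq0, gradientLIntegral, ← eLpNorm_ofReal_rpow μ _ hd,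
        ← ENNReal.rpow_mul, mul_div_cancel₀ _ hd.ne', ENNReal.ofReal_natCast]
      simp_rw [Real.norm_eq_abs]
      ring

theorem exists_weightedLIntegral_le (hE : 2 ≤ finrank ℝ E) {q s t : ℝ}
    (hq : (finrank ℝ E : ℝ) ≤ q) (hst : s < t) (ht : t < finrank ℝ E) :
    ∃ K : ℝ≥0, ∀ u : E → ℝ, ContDiff ℝ 1 u →
      weightedLIntegral μ u q t ≤
        K * (gradientLIntegral μ u ^ (q / finrank ℝ E) + weightedLIntegral μ u q s) := by
  let f : ContDiffBump (0 : E) := ⟨1, 2, one_pos, one_lt_two⟩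
  obtain ⟨K, hK⟩ := exists_setLIntegral_closedBall_le μ hE hq ht f
  have hc : 0 ≤ max 1 ((2 : ℝ) ^ s) := by positivity
  set c : ℝ≥0 := ⟨max 1 ((2 : ℝ) ^ s), hc⟩
  have hc' : (c : ℝ≥0∞) = ENNReal.ofReal (max 1 ((2 : ℝ) ^ s)) :=
    (ENNReal.ofReal_eq_coe_nnreal hc).symm
  refine ⟨K * (1 + c) + 1, fun u hu ↦ ?_⟩
  set W := weightedLIntegral μ u q s with hW
  set G := gradientLIntegral μ u ^ (q / finrank ℝ E)
  have hA : ∫⁻ x in closedBall 0 2 \ ball 0 1, ENNReal.ofReal (|u x| ^ q) ∂μ ≤ c * W := by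
    rw [hW, weightedLIntegral, ← lintegral_const_mul' _ _ ENNReal.coe_ne_top]
    refine (setLIntegral_mono' (isClosed_closedBall.measurableSet.diff
      isOpen_ball.measurableSet) fun x hx ↦ ?_).trans (setLIntegral_le_lintegral _ _)
    have hx2 : ‖x‖ ≤ 2 := by simpa using hx.1
    have hx1 : 1 ≤ ‖x‖ := by simpa using hx.2
    have hx0 : 0 < ‖x‖ := by linarith
    rw [hc', ← ENNReal.ofReal_mul hc]
    refine ENNReal.ofReal_le_ofReal ?_
    have hxs : ‖x‖ ^ s ≤ max 1 ((2 : ℝ) ^ s) := by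
      rcases le_total s 0 with hs | hs
      · exact (rpow_le_one_of_one_le_of_nonpos hx1 hs).trans (le_max_left _ _)
      · exact (rpow_le_rpow hx0.le hx2 hs).trans (le_max_right _ _)
    calc
      |u x| ^ q = ‖x‖ ^ s * (|u x| ^ q * ‖x‖ ^ (-s)) := by
        rw [rpow_neg hx0.le]
        field_simp
      _ ≤ _ := by gcongr
  have hout : ∫⁻ x in (closedBall 0 1)ᶜ, ENNReal.ofReal (|u x| ^ q * ‖x‖ ^ (-t)) ∂μ ≤ W := by
    refine (setLIntegral_mono' isClosed_closedBall.measurableSet.compl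
      fun x hx ↦ ENNReal.ofReal_le_ofReal ?_).trans (setLIntegral_le_lintegral _ _)
    have hx1 : 1 < ‖x‖ := by simpa using hx
    gcongr
    exact hx1.le
  calc
    weightedLIntegral μ u q t = _ :=
      (lintegral_add_compl _ (isClosed_closedBall (x := (0 : E)) (ε := 1)).measurableSet).symm
    _ ≤ K * (G + c * W) + W := add_le_add ((hK u hu).trans (by gcongr)) hout
    _ ≤ K * ((1 + c) * G + (1 + c) * W) + (G + W) := by
      gcongr
      · exact le_mul_of_one_le_left' le_self_add
      · exact le_add_self
      · exact le_add_self
    _ = _ := by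
      push_cast
      ring

theorem weightedLIntegral_comp_smul (u : E → ℝ) (q t : ℝ) {R : ℝ} (hR : 0 < R) :
    weightedLIntegral μ (fun x ↦ u (R • x)) q t =
      ENNReal.ofReal (R ^ (t - finrank ℝ E)) * weightedLIntegral μ u q t := by
  have h (x : E) : ENNReal.ofReal (|u (R • x)| ^ q * ‖x‖ ^ (-t)) =
      ENNReal.ofReal (R ^ t) * ENNReal.ofReal (|u (R • x)| ^ q * ‖R • x‖ ^ (-t)) := by
    rw [← ENNReal.ofReal_mul (by positivity), norm_smul, Real.norm_of_nonneg hR.le,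
      mul_rpow hR.le (norm_nonneg _), rpow_neg hR.le]
    congr 1
    field_simp
  simp_rw [weightedLIntegral, h]
  rw [lintegral_const_mul' _ _ ENNReal.ofReal_ne_top,
    lintegral_comp_smul_of_pos μ (fun x ↦ ENNReal.ofReal (|u x| ^ q * ‖x‖ ^ (-t))) hR, ← mul_assoc,
    ← ENNReal.ofReal_mul (by positivity), ← rpow_add hR, sub_eq_add_neg]

theorem gradientLIntegral_comp_smul (u : E → ℝ) {R : ℝ} (hR : 0 < R) :
    gradientLIntegral μ (fun x ↦ u (R • x)) = gradientLIntegral μ u := by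
  simp_rw [gradientLIntegral, fderiv_comp_smul, norm_smul, Real.norm_of_nonneg hR.le,
    mul_rpow hR.le (norm_nonneg _), ENNReal.ofReal_mul (rpow_nonneg hR.le _)]
  rw [lintegral_const_mul' _ _ ENNReal.ofReal_ne_top,
    lintegral_comp_smul_of_pos μ
      (fun x ↦ ENNReal.ofReal (‖fderiv ℝ u x‖ ^ (finrank ℝ E : ℝ))) hR, ← mul_assoc,
    ← ENNReal.ofReal_mul (by positivity), ← rpow_add hR, add_neg_cancel, rpow_zero,
    ENNReal.ofReal_one, one_mul]

theorem weightedLIntegral_lt_top (hE : 1 ≤ finrank ℝ E) {u : E → ℝ} (hu : Continuous u)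
    (hcu : HasCompactSupport u) {q t : ℝ} (hq : 0 < q) (ht : t < finrank ℝ E) :
    weightedLIntegral μ u q t < ∞ := by
  obtain ⟨M, hM⟩ := hu.bounded_above_of_compact_support hcu
  obtain ⟨R, hR⟩ := hcu.isCompact.isBounded.subset_closedBall 0
  calc
    weightedLIntegral μ u q t
      ≤ ∫⁻ x, (closedBall 0 R).indicator
          (fun x ↦ ENNReal.ofReal (M ^ q) * ENNReal.ofReal (‖x‖ ^ (-t))) x ∂μ := by
      refine lintegral_mono fun x ↦ ?_
      by_cases hx : x ∈ closedBall 0 R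
      · rw [Set.indicator_of_mem hx, ← ENNReal.ofReal_mul
          (rpow_nonneg ((norm_nonneg _).trans (hM x)) _)]
        refine ENNReal.ofReal_le_ofReal ?_
        gcongr
        exact hM x
      · rw [image_eq_zero_of_notMem_tsupport fun h ↦ hx (hR h)]
        simp [hq.ne']
    _ = ENNReal.ofReal (M ^ q) * ∫⁻ x in closedBall 0 R, ENNReal.ofReal (‖x‖ ^ (-t)) ∂μ := by
      rw [lintegral_indicator isClosed_closedBall.measurableSet,
        lintegral_const_mul' _ _ ENNReal.ofReal_ne_top]
    _ < ∞ := ENNReal.mul_lt_top ENNReal.ofReal_lt_top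
      (setLIntegral_closedBall_rpow_norm_lt_top μ hE ht R)

theorem gradientLIntegral_lt_top (hE : 1 ≤ finrank ℝ E) {u : E → ℝ} (hu : ContDiff ℝ 1 u)
    (hcu : HasCompactSupport u) : gradientLIntegral μ u < ∞ := by
  have h := weightedLIntegral_lt_top μ hE (hu.continuous_fderiv one_ne_zero).norm
    (hcu.fderiv ℝ).norm (q := finrank ℝ E) (t := 0) (by exact_mod_cast hE) (by exact_mod_cast hE)
  simpa [weightedLIntegral, gradientLIntegral] using h

end HaarMeasure

theorem le_two_mul_rpow_mul_rpow_of_forall_le {L K g S α β : ℝ} (hK : 0 ≤ K) (hg : 0 ≤ g)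
    (hS : 0 ≤ S) (hα : 0 < α) (hβ : 0 < β)
    (h : ∀ R : ℝ, 0 < R → L ≤ K * (R ^ α * g + R ^ (-β) * S)) :
    L ≤ 2 * K * (g ^ (β / (α + β)) * S ^ (α / (α + β))) := by
  have hpos : ∀ ε : ℝ, 0 < ε →
      L ≤ 2 * K * ((g + ε) ^ (β / (α + β)) * (S + ε) ^ (α / (α + β))) := by
    intro ε hε
    have hg' : 0 < g + ε := by positivity
    have hS' : 0 < S + ε := by positivity
    have hR : 0 < ((S + ε) / (g + ε)) ^ (1 / (α + β)) := by positivity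
    have hab : β / (α + β) = 1 - α / (α + β) := by field_simp; ring
    have hba : α / (α + β) = 1 - β / (α + β) := by field_simp; ring
    have h1 : (((S + ε) / (g + ε)) ^ (1 / (α + β))) ^ α * (g + ε) =
        (g + ε) ^ (β / (α + β)) * (S + ε) ^ (α / (α + β)) := by
      rw [← rpow_mul (by positivity), one_div_mul_eq_div, div_rpow hS'.le hg'.le, hab,
        rpow_sub hg', rpow_one]
      field_simp
    have h2 : (((S + ε) / (g + ε)) ^ (1 / (α + β))) ^ (-β) * (S + ε) =
        (g + ε) ^ (β / (α + β)) * (S + ε) ^ (α / (α + β)) := by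
      rw [← rpow_mul (by positivity), mul_neg, one_div_mul_eq_div, rpow_neg (by positivity),
        div_rpow hS'.le hg'.le, hba, rpow_sub hS', rpow_one]
      field_simp
    calc
      L ≤ K * ((((S + ε) / (g + ε)) ^ (1 / (α + β))) ^ α * g +
          (((S + ε) / (g + ε)) ^ (1 / (α + β))) ^ (-β) * S) := h _ hR
      _ ≤ K * ((((S + ε) / (g + ε)) ^ (1 / (α + β))) ^ α * (g + ε) +
          (((S + ε) / (g + ε)) ^ (1 / (α + β))) ^ (-β) * (S + ε)) := by
        gcongr <;> linarith
      _ = _ := by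
        rw [h1, h2]
        ring
  have hcont : ContinuousAt
      (fun ε : ℝ ↦ 2 * K * ((g + ε) ^ (β / (α + β)) * (S + ε) ^ (α / (α + β)))) 0 := by
    refine continuousAt_const.mul (ContinuousAt.mul ?_ ?_)
    · exact (by fun_prop : ContinuousAt (fun ε : ℝ ↦ g + ε) 0).rpow_const
        (Or.inr (by positivity))
    · exact (by fun_prop : ContinuousAt (fun ε : ℝ ↦ S + ε) 0).rpow_const
        (Or.inr (by positivity))
  have hlim := hcont.tendsto.mono_left (nhdsWithin_le_nhds (s := Set.Ioi 0))
  simp only [add_zero] at hlim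
  exact ge_of_tendsto hlim (eventually_nhdsWithin_of_forall hpos)

/-- **Caffarelli–Kohn–Nirenberg inequality, special case (inequality (2.6)).**
For `N ≥ 2`, `q ≥ N`, `s < t < N` and `a = (t-s)/(N-s)`, there is `C > 0` such that for all
smooth compactly supported `u : ℝ^N → ℝ`,
`(∫ |u|^q |x|^{-t})^{1/q} ≤ C (∫ |∇u|^N)^{a/N} (∫ |u|^q |x|^{-s})^{(1-a)/q}`. -/
theorem caffarelli_kohn_nirenberg_special (N : ℕ) (hN : 2 ≤ N) (q : ℝ) (hq : (N : ℝ) ≤ q)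
    (s t : ℝ) (hst : s < t) (htN : t < (N : ℝ)) :
    ∃ C : ℝ, 0 < C ∧
      ∀ u : EuclideanSpace ℝ (Fin N) → ℝ,
        ContDiff ℝ (⊤ : ℕ∞) u → HasCompactSupport u →
        (∫⁻ x, ENNReal.ofReal (|u x| ^ q * ‖x‖ ^ (-t))) ^ (1 / q)
          ≤ ENNReal.ofReal C *
            (∫⁻ x, ENNReal.ofReal (‖fderiv ℝ u x‖ ^ (N : ℝ))) ^
              (((t - s) / ((N : ℝ) - s)) / (N : ℝ)) *
            (∫⁻ x, ENNReal.ofReal (|u x| ^ q * ‖x‖ ^ (-s))) ^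
              ((1 - (t - s) / ((N : ℝ) - s)) / q) := by
  set E := EuclideanSpace ℝ (Fin N)
  have hE : Module.finrank ℝ E = N := finrank_euclideanSpace_fin
  have hE1 : 1 ≤ Module.finrank ℝ E := by rw [hE]; lia
  have hN0 : (0 : ℝ) < N := by positivity
  have hq0 : 0 < q := hN0.trans_le hq
  have hα : 0 < (N : ℝ) - t := sub_pos.2 htN
  have hβ : 0 < t - s := sub_pos.2 hst
  have hsum : (N : ℝ) - t + (t - s) = N - s := by ring
  have hNs : 0 < (N : ℝ) - s := by linarith
  obtain ⟨K, hK⟩ := exists_weightedLIntegral_le (volume : Measure E) (q := q) (s := s) (t := t)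
    (by rwa [hE]) (by rwa [hE]) hst (by rwa [hE])
  have hC : 0 < 2 * ((K : ℝ) + 1) := by positivity
  refine ⟨(2 * ((K : ℝ) + 1)) ^ (1 / q), by positivity, fun u hu hcu ↦ ?_⟩
  have hu1 : ContDiff ℝ 1 u := hu.of_le (by exact_mod_cast le_top)
  change weightedLIntegral volume u q t ^ (1 / q) ≤ _ *
    _ * weightedLIntegral volume u q s ^ ((1 - (t - s) / ((N : ℝ) - s)) / q)
  have hG : ∫⁻ x, ENNReal.ofReal (‖fderiv ℝ u x‖ ^ (N : ℝ)) = gradientLIntegral volume u := by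
    rw [gradientLIntegral, hE]
  rw [hG]
  have hLtop := weightedLIntegral_lt_top (volume : Measure E) hE1 hu1.continuous hcu hq0
    (t := t) (by rwa [hE])
  have hStop := weightedLIntegral_lt_top (volume : Measure E) hE1 hu1.continuous hcu hq0
    (t := s) (by rw [hE]; linarith)
  have hGtop := gradientLIntegral_lt_top (volume : Measure E) hE1 hu1 hcu
  set G := gradientLIntegral (volume : Measure E) u
  set L := weightedLIntegral (volume : Measure E) u q t
  set S := weightedLIntegral (volume : Measure E) u q s
  have hgtop : G ^ (q / N) ≠ ⊤ := ENNReal.rpow_ne_top_of_nonneg (by positivity) hGtop.ne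
  have hscale : ∀ R : ℝ, 0 < R → L.toReal ≤
      ((K : ℝ) + 1) * (R ^ ((N : ℝ) - t) * (G ^ (q / N)).toReal + R ^ (-(t - s)) * S.toReal) := by
    intro R hR
    have h := hK (fun x ↦ u (R • x)) (hu1.comp (contDiff_const_smul R))
    rw [weightedLIntegral_comp_smul _ _ _ _ hR, weightedLIntegral_comp_smul _ _ _ _ hR,
      gradientLIntegral_comp_smul _ _ hR, hE] at h
    have h' := ENNReal.toReal_mono (by finiteness) h
    rw [ENNReal.toReal_mul, ENNReal.toReal_mul, ENNReal.toReal_add hgtop (by finiteness),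
      ENNReal.toReal_mul, ENNReal.toReal_ofReal (by positivity),
      ENNReal.toReal_ofReal (by positivity), ENNReal.coe_toReal] at h'
    have e1 : R ^ ((N : ℝ) - t) * R ^ (t - (N : ℝ)) = 1 := by
      rw [← rpow_add hR]
      simp
    have e2 : R ^ ((N : ℝ) - t) * R ^ (s - (N : ℝ)) = R ^ (-(t - s)) := by
      rw [← rpow_add hR]
      congr 1
      ring
    calc
      L.toReal = R ^ ((N : ℝ) - t) * (R ^ (t - (N : ℝ)) * L.toReal) := by
        rw [← mul_assoc, e1, one_mul]
      _ ≤ R ^ ((N : ℝ) - t) *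
          (((K : ℝ) + 1) * ((G ^ (q / N)).toReal + R ^ (s - (N : ℝ)) * S.toReal)) := by
        refine mul_le_mul_of_nonneg_left (h'.trans ?_) (by positivity)
        gcongr
        linarith
      _ = _ := by
        rw [← e2]
        ring
  have hfin := le_two_mul_rpow_mul_rpow_of_forall_le (by positivity) ENNReal.toReal_nonneg
    ENNReal.toReal_nonneg hα hβ hscale
  have hfin' : L ≤ ENNReal.ofReal (2 * ((K : ℝ) + 1)) *
      ((G ^ (q / N)) ^ ((t - s) / (N - s)) * S ^ (1 - (t - s) / (N - s))) := by
    have ha : ((N : ℝ) - t) / (N - s) = 1 - (t - s) / (N - s) := by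
      field_simp
      ring
    have ha0 : 0 ≤ (t - s) / ((N : ℝ) - s) := by positivity
    have ha1 : 0 ≤ 1 - (t - s) / ((N : ℝ) - s) := ha ▸ by positivity
    rw [hsum, ha] at hfin
    rw [← ENNReal.ofReal_toReal hLtop.ne]
    refine (ENNReal.ofReal_le_ofReal hfin).trans_eq ?_
    rw [ENNReal.ofReal_mul hC.le,
      ENNReal.ofReal_mul (rpow_nonneg ENNReal.toReal_nonneg ((t - s) / ((N : ℝ) - s))),
      ← ENNReal.ofReal_rpow_of_nonneg ENNReal.toReal_nonneg ha0,
      ← ENNReal.ofReal_rpow_of_nonneg ENNReal.toReal_nonneg ha1,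
      ENNReal.ofReal_toReal hgtop, ENNReal.ofReal_toReal hStop.ne]
  refine (ENNReal.rpow_le_rpow hfin' (by positivity : 0 ≤ 1 / q)).trans_eq ?_
  rw [ENNReal.mul_rpow_of_nonneg _ _ (by positivity), ENNReal.mul_rpow_of_nonneg _ _ (by positivity),
    ENNReal.ofReal_rpow_of_pos hC, ← ENNReal.rpow_mul, ← ENNReal.rpow_mul, ← ENNReal.rpow_mul,
    mul_assoc]
  congr 3
  · field_simp
  · ring
end

section
/- Let N ≥ 2 and let t be a real number with 0 ≤ t < N. For a measurable function u : ℝ^N → ℝ define v : ℝ^N → ℝ by v(x) := ((N-t)/N)^{(N-1)/N} · u(|x|^{t/(N-t)} x). Then ∫_{ℝ^N} |v(x)|^N dx = ((N-t)/N)^N ∫_{ℝ^N} |u(y)|^N |y|^{-t} dy, where both sides are interpreted as values in [0, ∞]. -/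
open MeasureTheory Real

section PowerStretch

variable {E : Type*} [NormedAddCommGroup E] [InnerProductSpace ℝ E]

lemma norm_rpow_smul_self {a : ℝ} {x : E} (hx : x ≠ 0) :
    ‖‖x‖ ^ a • x‖ = ‖x‖ ^ (a + 1) := by
  rw [norm_smul, Real.norm_of_nonneg (by positivity), rpow_add_one (norm_ne_zero_iff.2 hx)]

lemma norm_rpow_smul_self_ne_zero {a : ℝ} {x : E} (hx : x ≠ 0) : ‖x‖ ^ a • x ≠ 0 :=
  smul_ne_zero (rpow_pos_of_pos (norm_pos_iff.2 hx) a).ne' hx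

lemma norm_rpow_smul_norm_rpow_smul {a b : ℝ} (hab : a + (a + 1) * b = 0) {x : E} (hx : x ≠ 0) :
    ‖‖x‖ ^ a • x‖ ^ b • ‖x‖ ^ a • x = x := by
  rw [norm_rpow_smul_self hx, smul_smul, ← rpow_mul (norm_nonneg x),
    ← rpow_add (norm_pos_iff.2 hx), add_comm, hab, rpow_zero, one_smul]

lemma bijOn_norm_rpow_smul {a : ℝ} (ha : -1 < a) :
    Set.BijOn (fun x : E ↦ ‖x‖ ^ a • x) {0}ᶜ {0}ᶜ := by
  have h : a + 1 ≠ 0 := by linarith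
  have hab : a + (a + 1) * (-a / (a + 1)) = 0 := by field_simp; ring
  have hba : -a / (a + 1) + (-a / (a + 1) + 1) * a = 0 := by field_simp; ring
  exact Set.InvOn.bijOn (f' := fun x : E ↦ ‖x‖ ^ (-a / (a + 1)) • x)
    ⟨fun _ hx ↦ norm_rpow_smul_norm_rpow_smul hab hx,
      fun _ hx ↦ norm_rpow_smul_norm_rpow_smul hba hx⟩
    (fun _ hx ↦ norm_rpow_smul_self_ne_zero hx) (fun _ hx ↦ norm_rpow_smul_self_ne_zero hx)

lemma hasFDerivAt_norm_rpow_of_ne_zero (a : ℝ) {x : E} (hx : x ≠ 0) :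
    HasFDerivAt (fun x : E ↦ ‖x‖ ^ a) ((a * ‖x‖ ^ (a - 2)) • innerSL ℝ x) x := by
  have hpos := norm_pos_iff.2 hx
  have key : ∀ (y : E) (p : ℝ), (‖y‖ ^ 2) ^ p = ‖y‖ ^ (2 * p) := fun y p ↦ by
    rw [← rpow_natCast, ← rpow_mul (norm_nonneg y), Nat.cast_ofNat]
  have h := (hasStrictFDerivAt_norm_sq x).hasFDerivAt.rpow_const (p := a / 2)
    (Or.inl (by positivity))
  simp only [key] at h
  convert h using 1
  · ext y
    congr 1
    ring
  · rw [← Nat.cast_smul_eq_nsmul ℝ, smul_smul, show 2 * (a / 2 - 1) = a - 2 by ring]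
    congr 1
    push_cast
    ring

lemma hasFDerivAt_norm_rpow_smul (a : ℝ) {x : E} (hx : x ≠ 0) :
    HasFDerivAt (fun x : E ↦ ‖x‖ ^ a • x)
      (‖x‖ ^ a • ContinuousLinearMap.id ℝ E +
        ((a * ‖x‖ ^ (a - 2)) • innerSL ℝ x).smulRight x) x :=
  (hasFDerivAt_norm_rpow_of_ne_zero a hx).smul (hasFDerivAt_id x)

variable [FiniteDimensional ℝ E]

lemma det_fderiv_norm_rpow_smul (a : ℝ) {x : E} (hx : x ≠ 0) :
    (‖x‖ ^ a • ContinuousLinearMap.id ℝ E +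
        ((a * ‖x‖ ^ (a - 2)) • innerSL ℝ x).smulRight x).det =
      (a + 1) * ‖x‖ ^ (a * Module.finrank ℝ E) := by
  have hpos := norm_pos_iff.2 hx
  have h : ((‖x‖ ^ a • ContinuousLinearMap.id ℝ E +
        ((a * ‖x‖ ^ (a - 2)) • innerSL ℝ x).smulRight x : E →L[ℝ] E) : E →ₗ[ℝ] E) =
      ‖x‖ ^ a • LinearMap.transvection
        ((a * ‖x‖ ^ (-2 : ℝ)) • (innerSL ℝ x : E →L[ℝ] ℝ).toLinearMap) x := by
    ext y
    simp [LinearMap.transvection.apply, smul_smul, sub_eq_add_neg, rpow_add hpos]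
    congr 1
    ring
  rw [ContinuousLinearMap.det, h, LinearMap.det_smul, LinearMap.transvection.det,
    rpow_mul hpos.le, rpow_natCast, mul_comm]
  congr 1
  simp [rpow_neg hpos.le]
  field_simp
  ring

variable [MeasurableSpace E] [BorelSpace E]

theorem lintegral_comp_norm_rpow_smul [Nontrivial E] (μ : Measure E) [μ.IsAddHaarMeasure] {a : ℝ}
    (ha : -1 < a) (g : E → ENNReal) :
    ∫⁻ x, g x ∂μ = ENNReal.ofReal (a + 1) *
      ∫⁻ x, ENNReal.ofReal (‖x‖ ^ (a * Module.finrank ℝ E)) * g (‖x‖ ^ a • x) ∂μ := by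
  have ha' : 0 ≤ a + 1 := by linarith
  have hμ : μ.restrict {0}ᶜ = μ := restrict_compl_singleton 0
  have hb := bijOn_norm_rpow_smul (E := E) ha
  have h := lintegral_image_eq_lintegral_abs_det_fderiv_mul μ
    (measurableSet_singleton (0 : E)).compl
    (fun x hx ↦ (hasFDerivAt_norm_rpow_smul a hx).hasFDerivWithinAt) hb.injOn g
  rw [hb.image_eq, hμ] at h
  rw [h, ← lintegral_const_mul' _ _ ENNReal.ofReal_ne_top]
  refine lintegral_congr_ae ?_
  filter_upwards [compl_mem_ae_iff.2 (measure_singleton (0 : E))] with x hx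
  rw [det_fderiv_norm_rpow_smul a hx, abs_of_nonneg (by positivity), ENNReal.ofReal_mul ha',
    mul_assoc]

end PowerStretch

/-- **Change of variables identity (2.11).** For `N ≥ 2`, `0 ≤ t < N`, a measurable
`u : ℝ^N → ℝ` and `v(x) = ((N-t)/N)^{(N-1)/N} u(|x|^{t/(N-t)} x)`, one has
`∫ |v(x)|^N dx = ((N-t)/N)^N ∫ |u(y)|^N |y|^{-t} dy` (as values in `[0,∞]`). -/
theorem change_of_variables_LN (N : ℕ) (hN : 2 ≤ N) (t : ℝ) (ht0 : 0 ≤ t)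
    (htN : t < (N : ℝ)) (u : EuclideanSpace ℝ (Fin N) → ℝ) (hu : Measurable u)
    (v : EuclideanSpace ℝ (Fin N) → ℝ)
    (hv : ∀ x, v x = (((N : ℝ) - t) / N) ^ (((N : ℝ) - 1) / N) *
      u (‖x‖ ^ (t / ((N : ℝ) - t)) • x)) :
    (∫⁻ x, ENNReal.ofReal (|v x| ^ (N : ℝ)))
      = ENNReal.ofReal ((((N : ℝ) - t) / N) ^ (N : ℝ)) *
        ∫⁻ y, ENNReal.ofReal (|u y| ^ (N : ℝ) * ‖y‖ ^ (-t)) := by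
  have hN0 : (0 : ℝ) < N := by positivity
  have hd : (0 : ℝ) < N - t := by linarith
  have : Nonempty (Fin N) := ⟨⟨0, by omega⟩⟩
  have ha : (-1 : ℝ) < t / (N - t) := by linarith [div_nonneg ht0 hd.le]
  rw [lintegral_comp_norm_rpow_smul volume ha
      fun y ↦ ENNReal.ofReal (|u y| ^ (N : ℝ) * ‖y‖ ^ (-t)),
    ← mul_assoc, ← ENNReal.ofReal_mul (by positivity),
    ← lintegral_const_mul' _ _ ENNReal.ofReal_ne_top]
  refine lintegral_congr_ae ?_
  filter_upwards [compl_mem_ae_iff.2 (measure_singleton (0 : EuclideanSpace ℝ (Fin N)))]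
    with x hx
  have hpos : 0 < ‖x‖ := norm_pos_iff.2 hx
  have hc : 0 < ((N : ℝ) - t) / N := by positivity
  have hconst : (((N : ℝ) - t) / N) ^ (N : ℝ) * (t / (N - t) + 1) =
      (((N : ℝ) - t) / N) ^ ((N : ℝ) - 1) := by
    rw [rpow_sub_one hc.ne']
    field_simp
    ring
  have hweight : ‖x‖ ^ (t / ((N : ℝ) - t) * N) * ‖x‖ ^ ((t / ((N : ℝ) - t) + 1) * -t) = 1 := by
    have hexp : t / ((N : ℝ) - t) * N + (t / ((N : ℝ) - t) + 1) * -t = 0 := by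
      field_simp
      ring
    rw [← rpow_add hpos, hexp, rpow_zero]
  rw [hconst, ← ENNReal.ofReal_mul (by positivity), ← ENNReal.ofReal_mul (by positivity),
    norm_rpow_smul_self hx, ← rpow_mul hpos.le, finrank_euclideanSpace_fin, hv, abs_mul,
    mul_rpow (abs_nonneg _) (abs_nonneg _), abs_of_nonneg (by positivity), ← rpow_mul hc.le,
    div_mul_cancel₀ _ hN0.ne', mul_left_comm (‖x‖ ^ _), hweight, mul_one]
end

section
/- Let N ≥ 2, let q > N, and let β ∈ (0,1). Then there exists a constant C > 0 depending only on β, N, and q such that the following holds: for every nondecreasing, locally absolutely continuous function w : ℝ → [0,∞) with w(t₀) = 0 for some t₀ ∈ ℝ and ∫_{-∞}^{∞} |w'(t)|^N dt ≤ 1, one has ∫_{-∞}^{∞} e^{β w(t)^{N/(N-1)}} w(t)^{q(N-1)/N} e^{-t} dt ≤ C ∫_{-∞}^{∞} w(t)^{q(N-1)/N} e^{-t} dt. -/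
open MeasureTheory Real

/-- Hölder's inequality on an interval, for a function in the unit ball of `L^p`. -/
lemma abs_intervalIntegral_le_rpow_of_lintegral_rpow_le_one {p a : ℝ} (hpa : p.HolderConjugate a)
    {f : ℝ → ℝ} (hf : Measurable f) (hf1 : (∫⁻ t, ENNReal.ofReal (|f t| ^ p)) ≤ 1)
    {x y : ℝ} (hxy : x ≤ y) : |∫ t in x..y, f t| ≤ (y - x) ^ (1 / a) := by
  have ha : 0 ≤ 1 / a := one_div_nonneg.2 hpa.symm.nonneg
  have hyx : 0 ≤ y - x := sub_nonneg.2 hxy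
  have holder := ENNReal.lintegral_mul_le_Lp_mul_Lq (volume.restrict (Set.Ioc x y)) hpa
    (f := fun t => ‖f t‖ₑ) (g := fun _ => 1) hf.enorm.aemeasurable aemeasurable_const
  have hp1 : (∫⁻ t in Set.Ioc x y, ‖f t‖ₑ ^ p) ≤ 1 := by
    refine (setLIntegral_le_lintegral _ _).trans (le_trans (le_of_eq ?_) hf1)
    refine lintegral_congr fun t => ?_
    rw [← ENNReal.ofReal_rpow_of_nonneg (abs_nonneg _) hpa.nonneg, ← Real.enorm_eq_ofReal_abs]
  have key : ‖∫ t in Set.Ioc x y, f t‖ₑ ≤ ENNReal.ofReal ((y - x) ^ (1 / a)) := by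
    calc ‖∫ t in Set.Ioc x y, f t‖ₑ ≤ ∫⁻ t in Set.Ioc x y, ‖f t‖ₑ :=
          enorm_integral_le_lintegral_enorm _
      _ ≤ (∫⁻ t in Set.Ioc x y, ‖f t‖ₑ ^ p) ^ (1 / p) *
            (∫⁻ _ in Set.Ioc x y, (1 : ENNReal) ^ a) ^ (1 / a) := by simpa using holder
      _ ≤ 1 * ENNReal.ofReal (y - x) ^ (1 / a) := by
          refine mul_le_mul' (ENNReal.rpow_le_one hp1 (one_div_nonneg.2 hpa.nonneg)) ?_
          simp
      _ = ENNReal.ofReal ((y - x) ^ (1 / a)) := by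
          rw [one_mul, ENNReal.ofReal_rpow_of_nonneg hyx ha]
  rw [intervalIntegral.integral_of_le hxy]
  rwa [Real.enorm_eq_ofReal_abs,
    ENNReal.ofReal_le_ofReal_iff (Real.rpow_nonneg hyx _)] at key

/-- Powers of `y ≥ 1` are dominated by arbitrarily slow exponentials. -/
lemma exists_rpow_le_mul_exp (r : ℝ) {ε : ℝ} (hε : 0 < ε) :
    ∃ K : ℝ, 0 < K ∧ ∀ y : ℝ, 1 ≤ y → y ^ r ≤ K * exp (ε * y) := by
  refine ⟨(⌈r⌉₊.factorial : ℝ) / ε ^ ⌈r⌉₊, by positivity, fun y hy => ?_⟩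
  have h1 : y ^ r ≤ y ^ ⌈r⌉₊ := by
    rw [← Real.rpow_natCast]
    exact Real.rpow_le_rpow_of_exponent_le hy (Nat.le_ceil r)
  have h2 := Real.pow_div_factorial_le_exp (x := ε * y) (by positivity) ⌈r⌉₊
  refine h1.trans ?_
  rw [div_le_iff₀ (by positivity), mul_pow] at h2
  rw [div_mul_eq_mul_div, le_div_iff₀ (by positivity)]
  linarith

/-- Subcritical multiples of `(1 + u) ^ a` are controlled by `u ^ a`. -/
lemma exists_mul_one_add_rpow_le {a β γ : ℝ} (ha : 0 < a) (hβ : 0 < β) (hβγ : β < γ) :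
    ∃ L : ℝ, ∀ u : ℝ, 0 ≤ u → β * (1 + u) ^ a ≤ γ * u ^ a + L := by
  set c := (γ / β) ^ (1 / a)
  have hγβ : 1 < γ / β := (one_lt_div hβ).2 hβγ
  have hc : 1 < c := Real.one_lt_rpow hγβ (by positivity)
  have hc0 : 0 < c - 1 := sub_pos.2 hc
  have hca : c ^ a = γ / β := by
    rw [← Real.rpow_mul (by linarith), one_div_mul_cancel ha.ne', Real.rpow_one]
  refine ⟨β * (1 + 1 / (c - 1)) ^ a, fun u hu => ?_⟩
  rcases le_total (1 / (c - 1)) u with h | h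
  · have h1 : 1 + u ≤ c * u := by
      rw [div_le_iff₀ hc0] at h
      linarith
    have h2 : (1 + u) ^ a ≤ γ / β * u ^ a := by
      rw [← hca, ← Real.mul_rpow (by linarith) hu]
      exact Real.rpow_le_rpow (by linarith) h1 ha.le
    calc β * (1 + u) ^ a ≤ β * (γ / β * u ^ a) := by gcongr
      _ = γ * u ^ a := by field_simp
      _ ≤ _ := le_add_of_nonneg_right (by positivity)
  · have h2 : (1 + u) ^ a ≤ (1 + 1 / (c - 1)) ^ a := by gcongr
    have h3 : 0 ≤ γ * u ^ a := mul_nonneg (by linarith) (by positivity)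
    nlinarith

/-- Subcritical exponential growth of `x ^ p * exp (β * x ^ a)` when `x ≤ 1 + s ^ (1 / a)`. -/
lemma exists_exp_mul_rpow_le_s16 {a β : ℝ} (p : ℝ) (ha : 0 < a) (hβ0 : 0 < β) (hβ1 : β < 1) :
    ∃ K γ : ℝ, 0 < K ∧ γ < 1 ∧ ∀ x s : ℝ, 1 ≤ x → 0 ≤ s → x ≤ 1 + s ^ (1 / a) →
      exp (β * x ^ a) * x ^ p ≤ K * exp (γ * s) := by
  obtain ⟨β₁, hββ₁, hβ₁1⟩ := exists_between hβ1
  obtain ⟨γ, hβ₁γ, hγ1⟩ := exists_between hβ₁1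
  obtain ⟨K, hK, hKy⟩ := exists_rpow_le_mul_exp (p / a) (sub_pos.2 hββ₁)
  obtain ⟨L, hL⟩ := exists_mul_one_add_rpow_le ha (hβ0.trans hββ₁) hβ₁γ
  refine ⟨K * exp L, γ, by positivity, hγ1, fun x s hx hs hxs => ?_⟩
  have hx0 : 0 ≤ x := by linarith
  have h1 : x ^ p ≤ K * exp ((β₁ - β) * x ^ a) := by
    have := hKy (x ^ a) (Real.one_le_rpow hx ha.le)
    rwa [← Real.rpow_mul hx0, mul_div_cancel₀ _ ha.ne'] at this
  have h2 : β₁ * x ^ a ≤ γ * s + L := by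
    have h3 := hL (s ^ (1 / a)) (by positivity)
    rw [← Real.rpow_mul hs, one_div_mul_cancel ha.ne', Real.rpow_one] at h3
    refine le_trans ?_ h3
    have := Real.rpow_le_rpow hx0 hxs ha.le
    exact mul_le_mul_of_nonneg_left this (hβ0.trans hββ₁).le
  calc exp (β * x ^ a) * x ^ p ≤ exp (β * x ^ a) * (K * exp ((β₁ - β) * x ^ a)) := by gcongr
    _ = K * exp (β₁ * x ^ a) := by
        rw [mul_left_comm, ← exp_add]
        ring_nf
    _ ≤ K * exp (γ * s + L) := by gcongr
    _ = K * exp L * exp (γ * s) := by rw [exp_add]; ring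

lemma setLIntegral_Ioi_ofReal_exp_mul {b : ℝ} (hb : b < 0) (c : ℝ) :
    ∫⁻ t in Set.Ioi c, ENNReal.ofReal (exp (b * t)) = ENNReal.ofReal (-exp (b * c) / b) := by
  rw [← integral_exp_mul_Ioi hb, ofReal_integral_eq_lintegral_ofReal
    (integrableOn_exp_mul_Ioi hb c) (Filter.Eventually.of_forall fun _ => (exp_pos _).le)]

/-- A monotone `1 / a`-Hölder function satisfies the subcritical exponential inequality. -/
lemma exists_lintegral_exp_mul_rpow_le {a p β : ℝ} (ha : 0 < a) (hp : 0 ≤ p) (hβ0 : 0 < β)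
    (hβ1 : β < 1) :
    ∃ C : ℝ, 0 < C ∧ ∀ w : ℝ → ℝ, Monotone w → Continuous w → (∀ t, 0 ≤ w t) →
      (∃ t₀, w t₀ = 0) → (∀ x y, x ≤ y → w y ≤ w x + (y - x) ^ (1 / a)) →
      (∫⁻ t, ENNReal.ofReal (exp (β * w t ^ a) * w t ^ p * exp (-t)))
        ≤ ENNReal.ofReal C * ∫⁻ t, ENNReal.ofReal (w t ^ p * exp (-t)) := by
  obtain ⟨K, γ, hK, hγ, hKγ⟩ := exists_exp_mul_rpow_le_s16 p ha hβ0 hβ1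
  have hγ0 : 0 < 1 - γ := sub_pos.2 hγ
  refine ⟨exp β + K / (1 - γ), by positivity, fun w hmono hcont hw0 ⟨t₀, ht₀⟩ hw => ?_⟩
  set I := ∫⁻ t, ENNReal.ofReal (w t ^ p * exp (-t))
  have hsmall : ∀ t, w t ≤ 1 → ENNReal.ofReal (exp (β * w t ^ a) * w t ^ p * exp (-t)) ≤
      ENNReal.ofReal (exp β) * ENNReal.ofReal (w t ^ p * exp (-t)) := fun t ht => by
    have hle : exp (β * w t ^ a) ≤ exp β := by
      rw [exp_le_exp]
      exact mul_le_of_le_one_right hβ0.le (Real.rpow_le_one (hw0 t) ht ha.le)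
    have hwp := Real.rpow_nonneg (hw0 t) p
    rw [← ENNReal.ofReal_mul (exp_pos _).le, mul_assoc]
    gcongr
  rw [ENNReal.ofReal_add (exp_pos _).le (by positivity), add_mul]
  by_cases hall : ∀ t, w t ≤ 1
  · refine (lintegral_mono fun t => hsmall t (hall t)).trans ?_
    rw [lintegral_const_mul' _ _ ENNReal.ofReal_ne_top]
    exact le_self_add
  push Not at hall
  obtain ⟨t₂, ht₂⟩ := hall
  obtain ⟨t₁, ht₁⟩ : ∃ t₁, w t₁ = 1 :=
    mem_range_of_exists_le_of_exists_ge hcont ⟨t₀, by rw [ht₀]; exact zero_le_one⟩ ⟨t₂, ht₂.le⟩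
  have hlower : ENNReal.ofReal (exp (-t₁)) ≤ I := by
    calc ENNReal.ofReal (exp (-t₁)) = ∫⁻ t in Set.Ioi t₁, ENNReal.ofReal (exp (-1 * t)) := by
          rw [setLIntegral_Ioi_ofReal_exp_mul (by norm_num)]
          simp
      _ ≤ ∫⁻ t in Set.Ioi t₁, ENNReal.ofReal (w t ^ p * exp (-t)) := by
          refine setLIntegral_mono' measurableSet_Ioi fun t ht => ENNReal.ofReal_le_ofReal ?_
          rw [neg_one_mul]
          refine le_mul_of_one_le_left (exp_pos _).le (Real.one_le_rpow ?_ hp)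
          exact ht₁ ▸ hmono (le_of_lt ht)
      _ ≤ I := setLIntegral_le_lintegral _ _
  set A := ENNReal.ofReal (K * exp (-(γ * t₁)))
  have hlarge : ∀ t, t₁ < t → ENNReal.ofReal (exp (β * w t ^ a) * w t ^ p * exp (-t)) ≤
      A * ENNReal.ofReal (exp ((γ - 1) * t)) := fun t ht => by
    have hb := hKγ (w t) (t - t₁) (ht₁ ▸ hmono ht.le) (sub_nonneg.2 ht.le)
      (ht₁ ▸ hw t₁ t ht.le)
    rw [← ENNReal.ofReal_mul (by positivity)]
    refine ENNReal.ofReal_le_ofReal ?_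
    calc _ ≤ K * exp (γ * (t - t₁)) * exp (-t) := by gcongr
      _ = _ := by
        rw [mul_assoc, mul_assoc, ← exp_add, ← exp_add]
        ring_nf
  have htail : (∫⁻ t in Set.Ioi t₁, A * ENNReal.ofReal (exp ((γ - 1) * t))) =
      ENNReal.ofReal (K / (1 - γ)) * ENNReal.ofReal (exp (-t₁)) := by
    rw [lintegral_const_mul' _ _ ENNReal.ofReal_ne_top,
      setLIntegral_Ioi_ofReal_exp_mul (by linarith), ← ENNReal.ofReal_mul (by positivity),
      ← ENNReal.ofReal_mul (by positivity)]
    congr 1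
    have he : exp (-t₁) = exp (-(γ * t₁)) * exp ((γ - 1) * t₁) := by
      rw [← exp_add]
      ring_nf
    rw [he, ← neg_sub 1 γ, neg_div_neg_eq]
    ring
  rw [← lintegral_add_compl _ (measurableSet_Iic (a := t₁)), Set.compl_Iic]
  gcongr ?_ + ?_
  · calc _ ≤ ∫⁻ t in Set.Iic t₁, ENNReal.ofReal (exp β) * ENNReal.ofReal (w t ^ p * exp (-t)) :=
          setLIntegral_mono' measurableSet_Iic fun t ht => hsmall t (ht₁ ▸ hmono ht)
      _ ≤ ∫⁻ t, ENNReal.ofReal (exp β) * ENNReal.ofReal (w t ^ p * exp (-t)) :=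
          setLIntegral_le_lintegral _ _
      _ = ENNReal.ofReal (exp β) * I := lintegral_const_mul' _ _ ENNReal.ofReal_ne_top
  · calc _ ≤ ∫⁻ t in Set.Ioi t₁, A * ENNReal.ofReal (exp ((γ - 1) * t)) :=
          setLIntegral_mono' measurableSet_Ioi hlarge
      _ ≤ ENNReal.ofReal (K / (1 - γ)) * I := by
          rw [htail]
          gcongr

/-- A function with a modulus of continuity `h ↦ h ^ r`, `r > 0`, is continuous. -/
lemma continuous_of_abs_sub_le_rpow {w : ℝ → ℝ} {r : ℝ} (hr : 0 < r)
    (hw : ∀ x y, x ≤ y → |w y - w x| ≤ (y - x) ^ r) : Continuous w := by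
  have hle : ∀ x y, |w y - w x| ≤ |y - x| ^ r := fun x y => by
    rcases le_total x y with h | h
    · rw [abs_of_nonneg (sub_nonneg.2 h)]
      exact hw x y h
    · rw [abs_sub_comm, abs_sub_comm y x, abs_of_nonneg (sub_nonneg.2 h)]
      exact hw y x h
  refine continuous_iff_continuousAt.2 fun x => tendsto_iff_dist_tendsto_zero.2 ?_
  refine squeeze_zero (fun _ => dist_nonneg) (fun y => hle x y) ?_
  have hc : Continuous fun y : ℝ => |y - x| ^ r :=
    (continuous_abs.comp (continuous_id.sub continuous_const)).rpow_const fun _ => Or.inr hr.le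
  simpa [Real.zero_rpow hr.ne'] using hc.tendsto x



/-- **One-dimensional inequality (3.20).** For `N ≥ 2`, `q > N` and `β ∈ (0,1)` there is
`C > 0` (depending only on `β`, `N`, `q`) such that for every nondecreasing, locally
absolutely continuous `w : ℝ → [0,∞)` (encoded via a derivative `w'` satisfying the
fundamental theorem of calculus) with `w(t₀) = 0` for some `t₀` and `∫ |w'|^N dt ≤ 1`,
one has `∫ e^{β w^{N/(N-1)}} w^{q(N-1)/N} e^{-t} dt ≤ C ∫ w^{q(N-1)/N} e^{-t} dt`. -/
theorem one_dim_moser_trudinger_exp_pow (N : ℕ) (hN : 2 ≤ N) (q : ℝ) (hq : (N : ℝ) < q)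
    (β : ℝ) (hβ0 : 0 < β) (hβ1 : β < 1) :
    ∃ C : ℝ, 0 < C ∧
      ∀ w w' : ℝ → ℝ,
        Monotone w → (∀ t, 0 ≤ w t) → (∃ t₀, w t₀ = 0) →
        Measurable w' →
        (∀ a b : ℝ, w b - w a = ∫ t in a..b, w' t) →
        (∫⁻ t, ENNReal.ofReal (|w' t| ^ (N : ℝ))) ≤ 1 →
        (∫⁻ t, ENNReal.ofReal
            (Real.exp (β * w t ^ ((N : ℝ) / ((N : ℝ) - 1))) *
              w t ^ (q * ((N : ℝ) - 1) / N) * Real.exp (-t)))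
          ≤ ENNReal.ofReal C *
            ∫⁻ t, ENNReal.ofReal (w t ^ (q * ((N : ℝ) - 1) / N) * Real.exp (-t)) := by
  have hN1 : (1 : ℝ) < N := by exact_mod_cast hN
  have hconj : (N : ℝ).HolderConjugate ((N : ℝ) / ((N : ℝ) - 1)) := .conjExponent hN1
  have hp : 0 ≤ q * ((N : ℝ) - 1) / N :=
    div_nonneg (mul_nonneg (by linarith) (by linarith)) (by linarith)
  obtain ⟨C, hC, hCw⟩ := exists_lintegral_exp_mul_rpow_le hconj.symm.pos hp hβ0 hβ1
  refine ⟨C, hC, fun w w' hmono hw0 hzero hmeas hftc hnorm => ?_⟩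
  have hholder : ∀ x y, x ≤ y →
      |w y - w x| ≤ (y - x) ^ (1 / ((N : ℝ) / ((N : ℝ) - 1))) := fun x y hxy => by
    rw [hftc x y]
    exact abs_intervalIntegral_le_rpow_of_lintegral_rpow_le_one hconj hmeas hnorm hxy
  exact hCw w hmono (continuous_of_abs_sub_le_rpow (one_div_pos.2 hconj.symm.pos) hholder) hw0
    hzero fun x y hxy => by linarith [le_of_abs_le (hholder x y hxy)]
end
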